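/- arXiv:1401.4370 — 14 statements merged into one kernel-verified Lean document; each statement's English description precedes it below -/
import Mathlib

section
/- Let f : [a,b] → ℝ be continuous on [a,b] and differentiable on (a,b), and suppose |f'(t)| ≤ M for all t ∈ (a,b). Then for every x ∈ [a,b], |f(x) − (1/(b−a))·∫_a^b f(t) dt| ≤ [((b−a)/2)² + (x − (a+b)/2)²]·M/(b−a). -/
open MeasureTheory intervalIntegral

theorem abs_sub_le_of_hasDerivAt_Ioo {a b M : ℝ} {f f' : ℝ → ℝ}
    (hcont : ContinuousOn f (Set.Icc a b))
    (hderiv : ∀ t ∈ Set.Ioo a b, HasDerivAt f (f' t) t)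
    (hM : ∀ t ∈ Set.Ioo a b, |f' t| ≤ M)
    {s t : ℝ} (hs : a ≤ s) (hst : s ≤ t) (ht : t ≤ b) :
    |f t - f s| ≤ M * (t - s) := by
  rcases hst.eq_or_lt with rfl | hlt
  · simp
  obtain ⟨c, hc, hslope⟩ := exists_hasDerivAt_eq_slope f f' hlt
    (hcont.mono (Set.Icc_subset_Icc hs ht))
    (fun u hu => hderiv u (Set.Ioo_subset_Ioo hs ht hu))
  have hpos : 0 < t - s := sub_pos.2 hlt
  rw [← div_le_iff₀ hpos, ← abs_of_pos hpos, ← abs_div, ← hslope]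
  exact hM c (Set.Ioo_subset_Ioo hs ht hc)

theorem integral_abs_sub_of_mem_Icc {a b x : ℝ} (hx : x ∈ Set.Icc a b) :
    ∫ t in a..b, |x - t| = ((b - a) / 2) ^ 2 + (x - (a + b) / 2) ^ 2 := by
  have hint : ∀ c d : ℝ, IntervalIntegrable (fun t => |x - t|) volume c d := fun c d =>
    Continuous.intervalIntegrable (by fun_prop) c d
  have hleft : ∫ t in a..x, |x - t| = ∫ t in a..x, (x - t) := by
    refine intervalIntegral.integral_congr fun t ht => ?_
    rw [Set.uIcc_of_le hx.1] at ht
    exact abs_of_nonneg (sub_nonneg.2 ht.2)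
  have hright : ∫ t in x..b, |x - t| = ∫ t in x..b, (t - x) := by
    refine intervalIntegral.integral_congr fun t ht => ?_
    rw [Set.uIcc_of_le hx.2] at ht
    exact (abs_of_nonpos (sub_nonpos.2 ht.1)).trans (neg_sub x t)
  rw [← intervalIntegral.integral_add_adjacent_intervals (hint a x) (hint x b), hleft, hright]
  simp only [intervalIntegral.integral_comp_sub_left (fun t => t),
    intervalIntegral.integral_comp_sub_right (fun t => t), integral_id]
  ring

/-- **Ostrowski's inequality.** If `f` is continuous on `[a,b]`, differentiable on `(a,b)`
with `|f'(t)| ≤ M` on `(a,b)`, then for every `x ∈ [a,b]`,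
`|f(x) − (1/(b−a))·∫_a^b f| ≤ (((b−a)/2)² + (x − (a+b)/2)²)·M/(b−a)`. -/
theorem ostrowski_inequality (a b : ℝ) (hab : a < b) (f f' : ℝ → ℝ) (M : ℝ)
    (hcont : ContinuousOn f (Set.Icc a b))
    (hderiv : ∀ t ∈ Set.Ioo a b, HasDerivAt f (f' t) t)
    (hM : ∀ t ∈ Set.Ioo a b, |f' t| ≤ M)
    (x : ℝ) (hx : x ∈ Set.Icc a b) :
    |f x - (1 / (b - a)) * ∫ t in a..b, f t| ≤
      (((b - a) / 2) ^ 2 + (x - (a + b) / 2) ^ 2) * M / (b - a) := by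
  have hpos : 0 < b - a := sub_pos.2 hab
  have hlip : ∀ t ∈ Set.Icc a b, |f x - f t| ≤ M * |x - t| := by
    intro t ht
    rcases le_total t x with h | h
    · rw [abs_of_nonneg (sub_nonneg.2 h)]
      exact abs_sub_le_of_hasDerivAt_Ioo hcont hderiv hM ht.1 h hx.2
    · rw [abs_sub_comm, abs_sub_comm x t, abs_of_nonneg (sub_nonneg.2 h)]
      exact abs_sub_le_of_hasDerivAt_Ioo hcont hderiv hM hx.1 h ht.2
  have hmean : f x - (1 / (b - a)) * ∫ t in a..b, f t =
      (∫ t in a..b, (f x - f t)) / (b - a) := by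
    rw [intervalIntegral.integral_sub intervalIntegrable_const
      (hcont.intervalIntegrable_of_Icc hab.le), intervalIntegral.integral_const, smul_eq_mul]
    field_simp
  rw [hmean, abs_div, abs_of_pos hpos]
  gcongr
  calc |∫ t in a..b, (f x - f t)| ≤ ∫ t in a..b, M * |x - t| := by
        rw [← Real.norm_eq_abs]
        refine intervalIntegral.norm_integral_le_of_norm_le hab.le
          (Filter.Eventually.of_forall fun t ht => hlip t (Set.Ioc_subset_Icc_self ht))
          (Continuous.intervalIntegrable (by fun_prop) a b)
    _ = (((b - a) / 2) ^ 2 + (x - (a + b) / 2) ^ 2) * M := by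
        rw [intervalIntegral.integral_const_mul, integral_abs_sub_of_mem_Icc hx, mul_comm]
end

section
/- Let f : [a,b] → ℝ be absolutely continuous with f' ∈ L_p[a,b], where p > 1 and 1/p + 1/q = 1. Then for every x ∈ [a,b], |f(x) − (1/(b−a))·∫_a^b f(t) dt| ≤ (1/(b−a))·[((x−a)^{q+1} + (b−x)^{q+1})/(q+1)]^{1/q}·‖f'‖_p. -/
open MeasureTheory intervalIntegral

/-- Integration by parts against an affine weight for a function with integrable density. -/
lemma integral_sub_const_mul_density {c d : ℝ} (hcd : c ≤ d) (k : ℝ) {f f' : ℝ → ℝ}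
    (hf' : IntervalIntegrable f' volume c d)
    (hf : ∀ y ∈ Set.Icc c d, f y = f c + ∫ t in c..y, f' t) :
    ∫ t in c..d, (t - k) * f' t = (d - k) * f d - (c - k) * f c - ∫ t in c..d, f t := by
  have hG : AbsolutelyContinuousOnInterval (fun y => ∫ t in c..y, f' t) c d :=
    hf'.absolutelyContinuousOnInterval_intervalIntegral (by simp)
  have hk : AbsolutelyContinuousOnInterval (fun t : ℝ => t - k) c d :=
    (LipschitzWith.id.sub (LipschitzWith.const k)).lipschitzOnWith.absolutelyContinuousOnInterval
  have hparts := hk.integral_mul_deriv_eq_deriv_mul hG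
  have hderiv : ∫ t in c..d, (t - k) * deriv (fun y => ∫ t in c..y, f' t) t
      = ∫ t in c..d, (t - k) * f' t := by
    apply intervalIntegral.integral_congr_ae
    filter_upwards [hf'.ae_hasDerivAt_integral] with t ht htcd
    rw [(ht (Set.uIoc_subset_uIcc htcd) c (by simp)).deriv]
  have hprim : ∫ t in c..d, f t = (d - c) * f c + ∫ y in c..d, ∫ t in c..y, f' t := by
    rw [← smul_eq_mul, ← intervalIntegral.integral_const,
      ← intervalIntegral.integral_add (by simp) hG.continuousOn.intervalIntegrable]
    refine intervalIntegral.integral_congr fun y hy => ?_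
    rw [Set.uIcc_of_le hcd] at hy
    exact hf y hy
  rw [← hderiv, hparts, hprim, hf d (Set.right_mem_Icc.2 hcd)]
  simp
  ring

/-- The Peano kernel of Montgomery's identity on `[a, b]` at the point `x`. -/
noncomputable def montgomeryKernel (a b x t : ℝ) : ℝ := if t ≤ x then t - a else t - b

lemma measurable_montgomeryKernel (a b x : ℝ) : Measurable (montgomeryKernel a b x) :=
  Measurable.ite measurableSet_Iic (by fun_prop) (by fun_prop)

lemma abs_montgomeryKernel_le {a b x t : ℝ} (ht : t ∈ Set.Ioc a b) :
    |montgomeryKernel a b x t| ≤ b - a := by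
  obtain ⟨h1, h2⟩ := ht
  unfold montgomeryKernel
  split_ifs <;> rw [abs_le] <;> constructor <;> linarith

lemma montgomeryKernel_of_le {x t : ℝ} (a b : ℝ) (h : t ≤ x) :
    montgomeryKernel a b x t = t - a := if_pos h

lemma montgomeryKernel_of_lt {x t : ℝ} (a b : ℝ) (h : x < t) :
    montgomeryKernel a b x t = t - b := if_neg h.not_ge

/-- **Montgomery's identity**. -/
lemma integral_montgomeryKernel_mul {a b x : ℝ} (hx : x ∈ Set.Icc a b) {f f' : ℝ → ℝ}
    (hf' : IntervalIntegrable f' volume a b)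
    (hf : ∀ y ∈ Set.Icc a b, f y = f a + ∫ t in a..y, f' t) :
    ∫ t in a..b, montgomeryKernel a b x t * f' t = (b - a) * f x - ∫ t in a..b, f t := by
  have hab : a ≤ b := hx.1.trans hx.2
  have hxu : x ∈ Set.uIcc a b := by rwa [Set.uIcc_of_le hab]
  have hleft : IntervalIntegrable f' volume a x :=
    hf'.mono_set (Set.uIcc_subset_uIcc_left hxu)
  have hright : IntervalIntegrable f' volume x b :=
    hf'.mono_set (Set.uIcc_subset_uIcc_right hxu)
  have hfc : ContinuousOn f (Set.uIcc a b) := by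
    have hG : AbsolutelyContinuousOnInterval (fun y => ∫ t in a..y, f' t) a b :=
      hf'.absolutelyContinuousOnInterval_intervalIntegral (by simp)
    refine ((continuousOn_const (c := f a)).add hG.continuousOn).congr fun y hy => ?_
    rw [Set.uIcc_of_le hab] at hy
    exact hf y hy
  have hcl : Set.EqOn (fun t => montgomeryKernel a b x t * f' t) (fun t => (t - a) * f' t)
      (Set.uIoc a x) := fun t ht => by
    rw [Set.uIoc_of_le hx.1] at ht
    simp only [montgomeryKernel_of_le a b ht.2]
  have hcr : Set.EqOn (fun t => montgomeryKernel a b x t * f' t) (fun t => (t - b) * f' t)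
      (Set.uIoc x b) := fun t ht => by
    rw [Set.uIoc_of_le hx.2] at ht
    simp only [montgomeryKernel_of_lt a b ht.1]
  rw [← intervalIntegral.integral_add_adjacent_intervals (b := x)
      ((hleft.continuousOn_mul (by fun_prop)).congr hcl.symm)
      ((hright.continuousOn_mul (by fun_prop)).congr hcr.symm),
    intervalIntegral.integral_congr_ae (ae_of_all _ hcl),
    intervalIntegral.integral_congr_ae (ae_of_all _ hcr),
    ← intervalIntegral.integral_add_adjacent_intervals (f := f) (b := x)
      (hfc.mono (Set.uIcc_subset_uIcc_left hxu)).intervalIntegrable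
      (hfc.mono (Set.uIcc_subset_uIcc_right hxu)).intervalIntegrable,
    integral_sub_const_mul_density hx.1 a hleft fun y hy => hf y ⟨hy.1, hy.2.trans hx.2⟩,
    integral_sub_const_mul_density hx.2 b hright fun y hy => ?_]
  · ring
  · have hyb : y ∈ Set.Icc a b := ⟨hx.1.trans hy.1, hy.2⟩
    rw [hf y hyb, hf x hx, add_assoc, intervalIntegral.integral_add_adjacent_intervals hleft
      (hright.mono_set (Set.uIcc_subset_uIcc_left (by rwa [Set.uIcc_of_le hx.2])))]

lemma integral_abs_montgomeryKernel_rpow {a b x q : ℝ} (hx : x ∈ Set.Icc a b) (hq : 0 < q) :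
    ∫ t in a..b, |montgomeryKernel a b x t| ^ q
      = ((x - a) ^ (q + 1) + (b - x) ^ (q + 1)) / (q + 1) := by
  have hcl : Set.EqOn (fun t => |montgomeryKernel a b x t| ^ q) (fun t => (t - a) ^ q)
      (Set.uIoc a x) := fun t ht => by
    rw [Set.uIoc_of_le hx.1] at ht
    simp only [montgomeryKernel_of_le a b ht.2, abs_of_pos (sub_pos.2 ht.1)]
  have hcr : Set.EqOn (fun t => |montgomeryKernel a b x t| ^ q) (fun t => (b - t) ^ q)
      (Set.uIoc x b) := fun t ht => by
    rw [Set.uIoc_of_le hx.2] at ht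
    simp only [montgomeryKernel_of_lt a b ht.1, abs_sub_comm t b, abs_of_nonneg (sub_nonneg.2 ht.2)]
  have hl : Continuous fun t : ℝ => (t - a) ^ q :=
    (continuous_id.sub continuous_const).rpow_const fun _ => Or.inr hq.le
  have hr : Continuous fun t : ℝ => (b - t) ^ q :=
    (continuous_const.sub continuous_id).rpow_const fun _ => Or.inr hq.le
  rw [← intervalIntegral.integral_add_adjacent_intervals (b := x)
      ((hl.intervalIntegrable a x).congr hcl.symm)
      ((hr.intervalIntegrable x b).congr hcr.symm),
    intervalIntegral.integral_congr_ae (ae_of_all _ hcl),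
    intervalIntegral.integral_congr_ae (ae_of_all _ hcr),
    intervalIntegral.integral_comp_sub_right (fun t => t ^ q),
    intervalIntegral.integral_comp_sub_left (fun t => t ^ q),
    integral_rpow (Or.inl (by linarith)), integral_rpow (Or.inl (by linarith)),
    sub_self, sub_self, Real.zero_rpow (by linarith)]
  ring

/-- **Ostrowski-type inequality for `f' ∈ L_p`** (Dragomir–Wang). If `f` is absolutely
continuous on `[a,b]` (expressed via the fundamental theorem of calculus with integrable
density `f'`) with `|f'|^p` integrable, where `p > 1` and `1/p + 1/q = 1`, then for every
`x ∈ [a,b]`,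
`|f(x) − (1/(b−a))·∫_a^b f| ≤ (1/(b−a))·(((x−a)^{q+1}+(b−x)^{q+1})/(q+1))^{1/q}·‖f'‖_p`. -/
theorem ostrowski_Lp (a b : ℝ) (hab : a < b) (f f' : ℝ → ℝ) (p q : ℝ)
    (hp : 1 < p) (hpq : 1 / p + 1 / q = 1)
    (hf'int : IntervalIntegrable f' volume a b)
    (hf'Lp : IntervalIntegrable (fun t => |f' t| ^ p) volume a b)
    (hftc : ∀ y ∈ Set.Icc a b, f y = f a + ∫ t in a..y, f' t)
    (x : ℝ) (hx : x ∈ Set.Icc a b) :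
    |f x - (1 / (b - a)) * ∫ t in a..b, f t| ≤
      (1 / (b - a)) * (((x - a) ^ (q + 1) + (b - x) ^ (q + 1)) / (q + 1)) ^ (1 / q) *
        (∫ t in a..b, |f' t| ^ p) ^ (1 / p) := by
  have hconj : p.HolderConjugate q :=
    Real.holderConjugate_iff.2 ⟨hp, by simpa only [one_div] using hpq⟩
  have hba : 0 < b - a := sub_pos.2 hab
  have hmeas : AEStronglyMeasurable f' (volume.restrict (Set.Ioc a b)) :=
    hf'int.1.aestronglyMeasurable
  have hf'mem : MemLp f' (ENNReal.ofReal p) (volume.restrict (Set.Ioc a b)) := by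
    rw [← integrable_norm_rpow_iff hmeas (by simpa using hconj.pos) ENNReal.ofReal_ne_top,
      ENNReal.toReal_ofReal hconj.nonneg]
    exact hf'Lp.1
  have hKmem : MemLp (montgomeryKernel a b x) (ENNReal.ofReal q)
      (volume.restrict (Set.Ioc a b)) :=
    MemLp.of_bound (measurable_montgomeryKernel a b x).aestronglyMeasurable (b - a)
      ((ae_restrict_iff' measurableSet_Ioc).2 (ae_of_all _ fun _ => abs_montgomeryKernel_le))
  have hholder := integral_mul_norm_le_Lp_mul_Lq hconj hf'mem hKmem
  simp only [Real.norm_eq_abs, ← intervalIntegral.integral_of_le hab.le,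
    integral_abs_montgomeryKernel_rpow hx hconj.symm.pos] at hholder
  have hbound : |(b - a) * f x - ∫ t in a..b, f t| ≤
      (((x - a) ^ (q + 1) + (b - x) ^ (q + 1)) / (q + 1)) ^ (1 / q) *
        (∫ t in a..b, |f' t| ^ p) ^ (1 / p) := by
    rw [← integral_montgomeryKernel_mul hx hf'int hftc, mul_comm (_ ^ (1 / q))]
    refine (intervalIntegral.abs_integral_le_integral_abs hab.le).trans ?_
    simpa only [abs_mul, mul_comm] using hholder
  have hscale : f x - (1 / (b - a)) * ∫ t in a..b, f t
      = (1 / (b - a)) * ((b - a) * f x - ∫ t in a..b, f t) := by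
    field_simp
  rw [hscale, abs_mul, abs_of_pos (one_div_pos.2 hba), mul_assoc]
  exact mul_le_mul_of_nonneg_left hbound (one_div_pos.2 hba).le
end

section
/- Let f : [a,b] → ℝ be absolutely continuous on [a,b]. Then for every x ∈ [a,b], |f(x) − (1/(b−a))·∫_a^b f(t) dt| ≤ (1/(b−a))·[(b−a)/2 + |x − (a+b)/2|]·‖f'‖_1. -/
open MeasureTheory intervalIntegral

/-- The increment of a primitive is bounded by the `L¹` norm of its density on any interval
containing both endpoints. -/
lemma abs_sub_le_integral_abs_of_eq_primitive {a b : ℝ} {f f' : ℝ → ℝ}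
    (hf' : IntervalIntegrable f' volume a b)
    (hf : ∀ y ∈ Set.Icc a b, f y = f a + ∫ t in a..y, f' t)
    {c d u v : ℝ} (hac : a ≤ c) (hcu : c ≤ u) (huv : u ≤ v) (hvd : v ≤ d) (hdb : d ≤ b) :
    |f v - f u| ≤ ∫ t in c..d, |f' t| := by
  have hint : ∀ {p q : ℝ}, a ≤ p → p ≤ q → q ≤ b → IntervalIntegrable f' volume p q := by
    intro p q hp hpq hq
    refine hf'.mono_set ?_
    rw [Set.uIcc_of_le hpq, Set.uIcc_of_le (hp.trans (hpq.trans hq))]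
    exact Set.Icc_subset_Icc hp hq
  have hau : a ≤ u := hac.trans hcu
  have hvb : v ≤ b := hvd.trans hdb
  have hsub : f v - f u = ∫ t in u..v, f' t := by
    rw [hf v ⟨hau.trans huv, hvb⟩, hf u ⟨hau, huv.trans hvb⟩,
      ← integral_add_adjacent_intervals (hint le_rfl hau (huv.trans hvb)) (hint hau huv hvb)]
    ring
  rw [hsub]
  refine (abs_integral_le_integral_abs huv).trans ?_
  exact integral_mono_interval hcu huv hvd (Filter.Eventually.of_forall fun t => abs_nonneg _)
    (hint hac (hcu.trans (huv.trans hvd)) hdb).abs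

/-- **Ostrowski-type inequality for `f' ∈ L_1`** (Dragomir–Wang). If `f` is absolutely
continuous on `[a,b]` (expressed via the fundamental theorem of calculus with integrable
density `f'`), then for every `x ∈ [a,b]`,
`|f(x) − (1/(b−a))·∫_a^b f| ≤ (1/(b−a))·((b−a)/2 + |x − (a+b)/2|)·‖f'‖_1`. -/
theorem ostrowski_L1 (a b : ℝ) (hab : a < b) (f f' : ℝ → ℝ)
    (hf'int : IntervalIntegrable f' volume a b)
    (hftc : ∀ y ∈ Set.Icc a b, f y = f a + ∫ t in a..y, f' t)
    (x : ℝ) (hx : x ∈ Set.Icc a b) :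
    |f x - (1 / (b - a)) * ∫ t in a..b, f t| ≤
      (1 / (b - a)) * ((b - a) / 2 + |x - (a + b) / 2|) * ∫ t in a..b, |f' t| := by
  obtain ⟨hax, hxb⟩ := hx
  have hxmem : x ∈ Set.uIcc a b := Set.mem_uIcc_of_le hax hxb
  have hcont : ContinuousOn f (Set.uIcc a b) := by
    have hprim := continuousOn_primitive_interval' hf'int Set.left_mem_uIcc
    refine ((continuousOn_const (c := f a)).add hprim).congr fun y hy => ?_
    rw [Set.uIcc_of_le hab.le] at hy
    exact hftc y hy
  have hfax : IntervalIntegrable f volume a x :=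
    (hcont.mono (Set.uIcc_subset_uIcc_left hxmem)).intervalIntegrable
  have hfxb : IntervalIntegrable f volume x b :=
    (hcont.mono (Set.uIcc_subset_uIcc_right hxmem)).intervalIntegrable
  have hL : |∫ t in a..x, (f x - f t)| ≤ (∫ t in a..x, |f' t|) * |x - a| := by
    rw [← Real.norm_eq_abs]
    refine intervalIntegral.norm_integral_le_of_norm_le_const fun t ht => ?_
    rw [Set.uIoc_of_le hax] at ht
    exact abs_sub_le_integral_abs_of_eq_primitive hf'int hftc le_rfl ht.1.le ht.2 le_rfl hxb
  have hR : |∫ t in x..b, (f x - f t)| ≤ (∫ t in x..b, |f' t|) * |b - x| := by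
    rw [← Real.norm_eq_abs]
    refine intervalIntegral.norm_integral_le_of_norm_le_const fun t ht => ?_
    rw [Set.uIoc_of_le hxb] at ht
    rw [Real.norm_eq_abs, abs_sub_comm]
    exact abs_sub_le_integral_abs_of_eq_primitive hf'int hftc hax le_rfl ht.1.le ht.2 le_rfl
  rw [intervalIntegral.integral_sub intervalIntegrable_const hfax, intervalIntegral.integral_const,
    smul_eq_mul, abs_of_nonneg (sub_nonneg.2 hax)] at hL
  rw [intervalIntegral.integral_sub intervalIntegrable_const hfxb, intervalIntegral.integral_const,
    smul_eq_mul, abs_of_nonneg (sub_nonneg.2 hxb)] at hR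
  have hA : 0 ≤ ∫ t in a..x, |f' t| := intervalIntegral.integral_nonneg hax fun t _ => abs_nonneg _
  have hB : 0 ≤ ∫ t in x..b, |f' t| := intervalIntegral.integral_nonneg hxb fun t _ => abs_nonneg _
  have hf'abs := hf'int.abs
  rw [← integral_add_adjacent_intervals hfax hfxb, ← integral_add_adjacent_intervals
    (hf'abs.mono_set (Set.uIcc_subset_uIcc_left hxmem))
    (hf'abs.mono_set (Set.uIcc_subset_uIcc_right hxmem))]
  have hpos : 0 < b - a := sub_pos.2 hab
  have hmean : f x - 1 / (b - a) * ((∫ t in a..x, f t) + ∫ t in x..b, f t) =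
      1 / (b - a) * (((x - a) * f x - ∫ t in a..x, f t) + ((b - x) * f x - ∫ t in x..b, f t)) := by
    field_simp
    ring
  rw [hmean, abs_mul, abs_of_pos (one_div_pos.2 hpos), mul_assoc]
  refine mul_le_mul_of_nonneg_left ?_ (one_div_pos.2 hpos).le
  refine (abs_add_le _ _).trans ((add_le_add hL hR).trans ?_)
  rw [mul_add, mul_comm _ (x - a), mul_comm _ (b - x)]
  refine add_le_add (mul_le_mul_of_nonneg_right ?_ hA) (mul_le_mul_of_nonneg_right ?_ hB)
  · linarith [le_abs_self (x - (a + b) / 2)]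
  · linarith [neg_abs_le (x - (a + b) / 2)]
end

section
/- Let f : [a,b] → ℝ be absolutely continuous with f' essentially bounded, let α, β ≥ 0 with α + β > 0, and let x ∈ (a,b). Then |f(x) − (1/(α+β))·[α·(1/(x−a))·∫_a^x f(t) dt + β·(1/(b−x))·∫_x^b f(t) dt]| ≤ (1/(2(α+β)))·[α(x−a) + β(b−x)]·‖f'‖_∞. -/
open MeasureTheory intervalIntegral

/-- An indefinite integral of a function with `|f'| ≤ M` almost everywhere is `M`-Lipschitz. -/
theorem lipschitzOnWith_of_eq_add_integral {a b : ℝ} {f f' : ℝ → ℝ} {M : NNReal}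
    (hf'int : IntervalIntegrable f' volume a b)
    (hftc : ∀ y ∈ Set.Icc a b, f y = f a + ∫ t in a..y, f' t)
    (hM : ∀ᵐ t ∂(volume.restrict (Set.Icc a b)), |f' t| ≤ M) :
    LipschitzOnWith M f (Set.Icc a b) := by
  refine LipschitzOnWith.of_dist_le_mul fun u hu v hv => ?_
  have hf'sub : ∀ y ∈ Set.Icc a b, IntervalIntegrable f' volume a y := fun y hy =>
    hf'int.mono_set (Set.uIcc_subset_uIcc_left (Set.Icc_subset_uIcc hy))
  have hsub : f u - f v = ∫ t in v..u, f' t := by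
    rw [hftc u hu, hftc v hv, add_sub_add_left_eq_sub,
      integral_interval_sub_left (hf'sub u hu) (hf'sub v hv)]
  rw [Real.dist_eq, Real.dist_eq, hsub]
  refine norm_integral_le_of_norm_le_const_ae (f := f') ?_
  filter_upwards [(ae_restrict_iff' measurableSet_Icc).mp hM] with t ht hmem
  exact ht (Set.uIcc_subset_Icc hv hu (Set.uIoc_subset_uIcc hmem))

/-- A Lipschitz function differs from its mean over an interval by at most `K / 2` times the
length of the interval, when evaluated at an endpoint. -/
theorem LipschitzOnWith.abs_sub_integral_mean_le {f : ℝ → ℝ} {K : NNReal} {x y : ℝ} (hxy : x ≠ y)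
    (hf : LipschitzOnWith K f (Set.uIcc x y)) :
    |f x - 1 / (y - x) * ∫ t in x..y, f t| ≤ K * |y - x| / 2 := by
  have hyx : y - x ≠ 0 := sub_ne_zero.mpr hxy.symm
  have hmem : ∀ s ∈ Set.Icc (0 : ℝ) 1, (y - x) * s + x ∈ Set.uIcc x y := fun s hs => by
    rw [← segment_eq_uIcc]
    exact ⟨1 - s, s, by linarith [hs.2], hs.1, by ring, by simp only [smul_eq_mul]; ring⟩
  have hmean : 1 / (y - x) * ∫ t in x..y, f t = ∫ s in (0 : ℝ)..1, f ((y - x) * s + x) := by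
    rw [integral_comp_mul_add f hyx x]
    simp
  have hcont : ContinuousOn (fun s => f ((y - x) * s + x)) (Set.uIcc 0 1) := by
    rw [Set.uIcc_of_le zero_le_one]
    exact hf.continuousOn.comp (by fun_prop) hmem
  have hdiff : f x - 1 / (y - x) * ∫ t in x..y, f t =
      ∫ s in (0 : ℝ)..1, (f x - f ((y - x) * s + x)) := by
    rw [hmean, integral_sub intervalIntegrable_const hcont.intervalIntegrable]
    simp
  have hbound : |∫ s in (0 : ℝ)..1, (f x - f ((y - x) * s + x))| ≤
      ∫ s in (0 : ℝ)..1, K * |y - x| * s := by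
    refine norm_integral_le_of_norm_le (f := fun s => f x - f ((y - x) * s + x))
      (g := fun s => K * |y - x| * s) zero_le_one (ae_of_all _ fun s hs => ?_)
      (Continuous.intervalIntegrable (by fun_prop) _ _)
    have h := hf.dist_le_mul x Set.left_mem_uIcc _ (hmem s (Set.Ioc_subset_Icc_self hs))
    rwa [Real.dist_eq, Real.dist_eq, abs_sub_comm x, add_sub_cancel_right, abs_mul,
      abs_of_nonneg hs.1.le, ← mul_assoc] at h
  rw [hdiff]
  refine hbound.trans_eq ?_
  rw [intervalIntegral.integral_const_mul, integral_id]
  ring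

/-- **Cerone's inequality, `L_∞` case.** If `f` is absolutely continuous on `[a,b]`
(expressed via the fundamental theorem of calculus with integrable density `f'`),
`f'` is essentially bounded by `M` on `[a,b]`, `α, β ≥ 0` with `α + β > 0`, and
`x ∈ (a,b)`, then
`|f(x) − (1/(α+β))·(α·M(f;a,x) + β·M(f;x,b))| ≤ (1/(2(α+β)))·(α(x−a)+β(b−x))·M`. -/
theorem cerone_Linfty (a b : ℝ) (hab : a < b) (f f' : ℝ → ℝ) (M α β : ℝ)
    (hα : 0 ≤ α) (hβ : 0 ≤ β) (hαβ : 0 < α + β)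
    (hf'int : IntervalIntegrable f' volume a b)
    (hftc : ∀ y ∈ Set.Icc a b, f y = f a + ∫ t in a..y, f' t)
    (hM : ∀ᵐ t ∂(volume.restrict (Set.Icc a b)), |f' t| ≤ M)
    (x : ℝ) (hx : x ∈ Set.Ioo a b) :
    |f x - (1 / (α + β)) * (α * ((1 / (x - a)) * ∫ t in a..x, f t) +
        β * ((1 / (b - x)) * ∫ t in x..b, f t))| ≤
      (1 / (2 * (α + β))) * (α * (x - a) + β * (b - x)) * M := by
  have hM0 : 0 ≤ M := by
    have : (ae (volume.restrict (Set.Icc a b))).NeBot := by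
      rw [ae_neBot, Ne, Measure.restrict_eq_zero]
      simp [hab]
    obtain ⟨t, ht⟩ := hM.exists
    exact (abs_nonneg _).trans ht
  lift M to NNReal using hM0
  have hlip := lipschitzOnWith_of_eq_add_integral hf'int hftc hM
  obtain ⟨hax, hxb⟩ := hx
  have hmem : x ∈ Set.Icc a b := ⟨hax.le, hxb.le⟩
  have hleft := (hlip.mono (Set.uIcc_subset_Icc hmem ⟨le_rfl, hab.le⟩)).abs_sub_integral_mean_le
    hax.ne'
  have hright := (hlip.mono (Set.uIcc_subset_Icc hmem ⟨hab.le, le_rfl⟩)).abs_sub_integral_mean_le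
    hxb.ne
  rw [integral_symm, ← neg_sub x a, one_div_neg_eq_neg_one_div, neg_mul_neg, abs_neg,
    abs_of_pos (sub_pos.mpr hax)] at hleft
  rw [abs_of_pos (sub_pos.mpr hxb)] at hright
  set A := 1 / (x - a) * ∫ t in a..x, f t
  set B := 1 / (b - x) * ∫ t in x..b, f t
  have hsplit : f x - 1 / (α + β) * (α * A + β * B) =
      1 / (α + β) * (α * (f x - A) + β * (f x - B)) := by
    field_simp
    ring
  calc |f x - 1 / (α + β) * (α * A + β * B)|
      = 1 / (α + β) * |α * (f x - A) + β * (f x - B)| := by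
        rw [hsplit, abs_mul, abs_of_pos (one_div_pos.mpr hαβ)]
    _ ≤ 1 / (α + β) * (α * |f x - A| + β * |f x - B|) := by
        gcongr
        refine (abs_add_le _ _).trans_eq ?_
        rw [abs_mul, abs_mul, abs_of_nonneg hα, abs_of_nonneg hβ]
    _ ≤ 1 / (α + β) * (α * (M * (x - a) / 2) + β * (M * (b - x) / 2)) := by
        gcongr
    _ = 1 / (2 * (α + β)) * (α * (x - a) + β * (b - x)) * M := by
        field_simp
end

section
/- Let f : [a,b] → ℝ be absolutely continuous with f' ∈ L_p[a,b], where p > 1 and 1/p + 1/q = 1, let α, β ≥ 0 with α + β > 0, and let x ∈ (a,b). Then |f(x) − (1/(α+β))·[α·(1/(x−a))·∫_a^x f(t) dt + β·(1/(b−x))·∫_x^b f(t) dt]| ≤ (1/((α+β)(q+1)^{1/q}))·[α^q(x−a) + β^q(b−x)]^{1/q}·‖f'‖_p. -/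
open MeasureTheory intervalIntegral

/-- Integration by parts against `t - k` for an antiderivative of an integrable function. -/
theorem integral_sub_mul_eq_of_eq_add_integral {F g : ℝ → ℝ} {c d : ℝ} (k : ℝ)
    (hg : IntervalIntegrable g volume c d)
    (hF : ∀ y ∈ Set.uIcc c d, F y = F c + ∫ t in c..y, g t) :
    ∫ t in c..d, (t - k) * g t = (d - k) * F d - (c - k) * F c - ∫ t in c..d, F t := by
  have hac : AbsolutelyContinuousOnInterval (fun y ↦ ∫ t in c..y, g t) c d :=
    hg.absolutelyContinuousOnInterval_intervalIntegral Set.left_mem_uIcc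
  have hsub : AbsolutelyContinuousOnInterval (fun t : ℝ ↦ t - k) c d :=
    ContDiffOn.absolutelyContinuousOnInterval (by fun_prop)
  have hparts := hsub.integral_mul_deriv_eq_deriv_mul hac
  have hderiv : ∫ t in c..d, (t - k) * deriv (fun y ↦ ∫ s in c..y, g s) t =
      ∫ t in c..d, (t - k) * g t := by
    apply intervalIntegral.integral_congr_ae
    filter_upwards [hg.ae_hasDerivAt_integral] with t ht htm
    rw [(ht (Set.uIoc_subset_uIcc htm) c Set.left_mem_uIcc).deriv]
  have hint : ∫ t in c..d, F t = (d - c) * F c + ∫ t in c..d, ∫ s in c..t, g s := by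
    rw [intervalIntegral.integral_congr hF, intervalIntegral.integral_add (by simp)
      hac.continuousOn.intervalIntegrable]
    simp
  rw [hderiv] at hparts
  simp only [deriv_sub_const, deriv_id'', one_mul, integral_same, mul_zero, sub_zero] at hparts
  rw [hparts, hint, hF d Set.right_mem_uIcc]
  ring

/-- Hölder's inequality on an interval, with a continuous weight. -/
theorem abs_integral_mul_le_of_continuous {k g : ℝ → ℝ} {c d p q : ℝ} (hcd : c ≤ d)
    (hpq : p.HolderConjugate q) (hk : Continuous k)
    (hg : IntervalIntegrable g volume c d)
    (hgp : IntervalIntegrable (fun t ↦ |g t| ^ p) volume c d) :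
    |∫ t in c..d, k t * g t| ≤
      (∫ t in c..d, |k t| ^ q) ^ (1 / q) * (∫ t in c..d, |g t| ^ p) ^ (1 / p) := by
  have hkq : IntervalIntegrable (fun t ↦ |k t| ^ q) volume c d :=
    (hk.abs.rpow_const fun _ ↦ Or.inr hpq.symm.nonneg).intervalIntegrable _ _
  refine (abs_integral_le_integral_abs hcd).trans ?_
  simp only [abs_mul]
  rw [intervalIntegrable_iff_integrableOn_Ioc_of_le hcd] at hg hgp hkq
  simp only [integral_of_le hcd]
  have memLp {h : ℝ → ℝ} {r : ℝ} (hr : 0 < r)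
      (hm : AEStronglyMeasurable h (volume.restrict (Set.Ioc c d)))
      (hi : IntegrableOn (fun t ↦ |h t| ^ r) (Set.Ioc c d)) :
      MemLp h (ENNReal.ofReal r) (volume.restrict (Set.Ioc c d)) := by
    rw [← integrable_norm_rpow_iff hm (by simpa using hr) ENNReal.ofReal_ne_top,
      ENNReal.toReal_ofReal hr.le]
    exact hi
  exact integral_mul_norm_le_Lp_mul_Lq hpq.symm
    (memLp hpq.symm.pos hk.aestronglyMeasurable hkq) (memLp hpq.pos hg.1 hgp)

theorem integral_abs_sub_left_rpow {c d q : ℝ} (hcd : c ≤ d) (hq : 0 < q) :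
    ∫ t in c..d, |t - c| ^ q = (d - c) ^ (q + 1) / (q + 1) := by
  have h : ∫ t in c..d, |t - c| ^ q = ∫ t in c..d, (t - c) ^ q := by
    refine intervalIntegral.integral_congr fun t ht ↦ ?_
    rw [Set.uIcc_of_le hcd] at ht
    simp only [abs_of_nonneg (sub_nonneg.2 ht.1)]
  rw [h, integral_comp_sub_right (fun t ↦ t ^ q), integral_rpow (Or.inl (by linarith))]
  simp [Real.zero_rpow (by linarith : q + 1 ≠ 0)]

theorem integral_abs_sub_right_rpow {c d q : ℝ} (hcd : c ≤ d) (hq : 0 < q) :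
    ∫ t in c..d, |t - d| ^ q = (d - c) ^ (q + 1) / (q + 1) := by
  have h := integral_comp_sub_left (a := c) (b := d) (fun t ↦ |t - c| ^ q) (c + d)
  simp only [add_sub_cancel_right, add_sub_cancel_left] at h
  rw [integral_abs_sub_left_rpow hcd hq] at h
  rw [← h]
  refine intervalIntegral.integral_congr fun t _ ↦ ?_
  rw [abs_sub_comm]
  ring_nf

theorem mul_inv_mul_rpow_div_rpow {r u q : ℝ} (hr : 0 ≤ r) (hu : 0 < u) (hq : 0 < q) :
    r * (1 / u) * (u ^ (q + 1) / (q + 1)) ^ (1 / q) =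
      (r ^ q * u) ^ (1 / q) / (q + 1) ^ (1 / q) := by
  have hpow {y : ℝ} (hy : 0 ≤ y) : (y ^ q) ^ (1 / q) = y := by
    rw [one_div, Real.rpow_rpow_inv hy hq.ne']
  rw [Real.div_rpow (by positivity) (by positivity), Real.rpow_add_one hu.ne',
    Real.mul_rpow (by positivity) hu.le, Real.mul_rpow (by positivity) hu.le, hpow hr, hpow hu.le]
  field_simp

/-- Hölder's inequality for two terms. -/
theorem rpow_mul_rpow_add_le {s s' t t' p q : ℝ} (hpq : p.HolderConjugate q)
    (hs : 0 ≤ s) (hs' : 0 ≤ s') (ht : 0 ≤ t) (ht' : 0 ≤ t') :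
    s ^ (1 / q) * t ^ (1 / p) + s' ^ (1 / q) * t' ^ (1 / p) ≤
      (s + s') ^ (1 / q) * (t + t') ^ (1 / p) := by
  have h := Real.inner_le_Lp_mul_Lq_of_nonneg Finset.univ hpq.symm
    (f := ![s ^ (1 / q), s' ^ (1 / q)]) (g := ![t ^ (1 / p), t' ^ (1 / p)])
    (by simp [Fin.forall_fin_two, Real.rpow_nonneg, *])
    (by simp [Fin.forall_fin_two, Real.rpow_nonneg, *])
  simpa [Fin.sum_univ_two, Real.rpow_inv_rpow, hpq.ne_zero, hpq.symm.ne_zero, *] using h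

/-- **Cerone's inequality, `L_p` case.** If `f` is absolutely continuous on `[a,b]`
(expressed via the fundamental theorem of calculus with integrable density `f'`),
`|f'|^p` is integrable where `p > 1`, `1/p + 1/q = 1`, `α, β ≥ 0` with `α + β > 0`, and
`x ∈ (a,b)`, then
`|f(x) − (1/(α+β))·(α·M(f;a,x) + β·M(f;x,b))|
  ≤ (1/((α+β)(q+1)^{1/q}))·(α^q(x−a)+β^q(b−x))^{1/q}·‖f'‖_p`. -/
theorem cerone_Lp (a b : ℝ) (hab : a < b) (f f' : ℝ → ℝ) (p q α β : ℝ)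
    (hp : 1 < p) (hpq : 1 / p + 1 / q = 1)
    (hα : 0 ≤ α) (hβ : 0 ≤ β) (hαβ : 0 < α + β)
    (hf'int : IntervalIntegrable f' volume a b)
    (hf'Lp : IntervalIntegrable (fun t => |f' t| ^ p) volume a b)
    (hftc : ∀ y ∈ Set.Icc a b, f y = f a + ∫ t in a..y, f' t)
    (x : ℝ) (hx : x ∈ Set.Ioo a b) :
    |f x - (1 / (α + β)) * (α * ((1 / (x - a)) * ∫ t in a..x, f t) +
        β * ((1 / (b - x)) * ∫ t in x..b, f t))| ≤
      (1 / ((α + β) * (q + 1) ^ (1 / q))) *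
        (α ^ q * (x - a) + β ^ q * (b - x)) ^ (1 / q) *
        (∫ t in a..b, |f' t| ^ p) ^ (1 / p) := by

  have hpq' : p.HolderConjugate q :=
    Real.holderConjugate_iff.2 ⟨hp, by simpa only [one_div] using hpq⟩
  have hq : 0 < q := hpq'.symm.pos
  obtain ⟨hax, hxb⟩ := hx
  have hsub₁ : Set.uIcc a x ⊆ Set.uIcc a b := Set.uIcc_subset_uIcc_left
    (by rw [Set.uIcc_of_le hab.le]; exact ⟨hax.le, hxb.le⟩)
  have hsub₂ : Set.uIcc x b ⊆ Set.uIcc a b := Set.uIcc_subset_uIcc_right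
    (by rw [Set.uIcc_of_le hab.le]; exact ⟨hax.le, hxb.le⟩)
  have hint₁ := hf'int.mono_set hsub₁
  have hint₂ := hf'int.mono_set hsub₂
  have hLp₁ := hf'Lp.mono_set hsub₁
  have hLp₂ := hf'Lp.mono_set hsub₂
  have hparts₁ := integral_sub_mul_eq_of_eq_add_integral a hint₁ fun y hy ↦
    hftc y (Set.uIcc_of_le hab.le ▸ hsub₁ hy)
  have hparts₂ := integral_sub_mul_eq_of_eq_add_integral (F := f) b hint₂ fun y hy ↦ by
    have hyb := hsub₂ hy
    rw [hftc y (Set.uIcc_of_le hab.le ▸ hyb), hftc x ⟨hax.le, hxb.le⟩, add_assoc,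
      integral_add_adjacent_intervals hint₁
        (hint₂.mono_set (Set.uIcc_subset_uIcc_left hy))]
  have hholder₁ := abs_integral_mul_le_of_continuous hax.le hpq'
    (k := fun t ↦ t - a) (by fun_prop) hint₁ hLp₁
  have hholder₂ := abs_integral_mul_le_of_continuous hxb.le hpq'
    (k := fun t ↦ t - b) (by fun_prop) hint₂ hLp₂
  rw [integral_abs_sub_left_rpow hax.le hq] at hholder₁
  rw [integral_abs_sub_right_rpow hxb.le hq] at hholder₂
  have hu : 0 < x - a := sub_pos.2 hax
  have hv : 0 < b - x := sub_pos.2 hxb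
  have hident : f x - (1 / (α + β)) * (α * ((1 / (x - a)) * ∫ t in a..x, f t) +
        β * ((1 / (b - x)) * ∫ t in x..b, f t)) =
      (1 / (α + β)) * (α * (1 / (x - a)) * (∫ t in a..x, (t - a) * f' t) +
        β * (1 / (b - x)) * ∫ t in x..b, (t - b) * f' t) := by
    rw [hparts₁, hparts₂]
    field_simp
    ring
  rw [hident, abs_mul, abs_of_pos (one_div_pos.2 hαβ),
    ← integral_add_adjacent_intervals hLp₁ hLp₂]
  have hnonneg₁ : 0 ≤ ∫ t in a..x, |f' t| ^ p :=
    integral_nonneg hax.le fun t _ ↦ by positivity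
  have hnonneg₂ : 0 ≤ ∫ t in x..b, |f' t| ^ p :=
    integral_nonneg hxb.le fun t _ ↦ by positivity
  have hdiscrete := rpow_mul_rpow_add_le hpq' (s := α ^ q * (x - a)) (s' := β ^ q * (b - x))
    (by positivity) (by positivity) hnonneg₁ hnonneg₂
  set P₁ := ∫ t in a..x, |f' t| ^ p
  set P₂ := ∫ t in x..b, |f' t| ^ p
  calc
    _ ≤ 1 / (α + β) * (α * (1 / (x - a)) * |∫ t in a..x, (t - a) * f' t| +
        β * (1 / (b - x)) * |∫ t in x..b, (t - b) * f' t|) := by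
      gcongr
      refine (abs_add_le _ _).trans_eq ?_
      rw [abs_mul, abs_mul (β * _), abs_of_nonneg (by positivity : 0 ≤ α * (1 / (x - a))),
        abs_of_nonneg (by positivity : 0 ≤ β * (1 / (b - x)))]
    _ ≤ 1 / (α + β) *
        (α * (1 / (x - a)) * (((x - a) ^ (q + 1) / (q + 1)) ^ (1 / q) * P₁ ^ (1 / p)) +
        β * (1 / (b - x)) * (((b - x) ^ (q + 1) / (q + 1)) ^ (1 / q) * P₂ ^ (1 / p))) := by
      gcongr
    _ = 1 / ((α + β) * (q + 1) ^ (1 / q)) *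
        ((α ^ q * (x - a)) ^ (1 / q) * P₁ ^ (1 / p) +
          (β ^ q * (b - x)) ^ (1 / q) * P₂ ^ (1 / p)) := by
      rw [← mul_assoc (α * _), ← mul_assoc (β * _), mul_inv_mul_rpow_div_rpow hα hu hq,
        mul_inv_mul_rpow_div_rpow hβ hv hq]
      field_simp
    _ ≤ _ := by
      rw [mul_assoc (1 / ((α + β) * (q + 1) ^ (1 / q)))]
      gcongr
end

section
/- Let f : [a,b] → ℝ be absolutely continuous, let α, β ≥ 0 with α + β > 0, and let x ∈ (a,b). Then |f(x) − (1/(α+β))·[α·(1/(x−a))·∫_a^x f(t) dt + β·(1/(b−x))·∫_x^b f(t) dt]| ≤ (1/2)·(1 + |α−β|/(α+β))·‖f'‖_1. -/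
open MeasureTheory intervalIntegral

/-- A number within `K` of every value of `f` on `[c,d]` is within `K` of the mean of `f`. -/
theorem abs_sub_intervalMean_le {c d K y : ℝ} {f : ℝ → ℝ} (hcd : c < d)
    (hf : IntervalIntegrable f volume c d) (h : ∀ t ∈ Set.Icc c d, |y - f t| ≤ K) :
    |y - (1 / (d - c)) * ∫ t in c..d, f t| ≤ K := by
  have hpos : 0 < d - c := sub_pos.2 hcd
  have hbound : ‖∫ t in c..d, (y - f t)‖ ≤ K * |d - c| := by
    refine norm_integral_le_of_norm_le_const fun t ht => h t ?_
    rw [Set.uIoc_of_le hcd.le] at ht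
    exact Set.Ioc_subset_Icc_self ht
  rw [Real.norm_eq_abs, integral_sub intervalIntegrable_const hf, intervalIntegral.integral_const,
    smul_eq_mul, abs_of_pos hpos] at hbound
  have hrw : y - (1 / (d - c)) * ∫ t in c..d, f t =
      ((d - c) * y - ∫ t in c..d, f t) / (d - c) := by
    field_simp
  rw [hrw, abs_div, abs_of_pos hpos]
  exact (div_le_iff₀ hpos).2 hbound

/-- A weighted average of `A, B ≥ 0` is at most the larger relative weight times `A + B`. -/
theorem weighted_average_le_add {α β A B : ℝ} (hαβ : 0 < α + β) (hA : 0 ≤ A) (hB : 0 ≤ B) :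
    (1 / (α + β)) * (α * A + β * B) ≤
      (1 / 2) * (1 + |α - β| / (α + β)) * (A + B) := by
  have hrw : (1 / 2) * (1 + |α - β| / (α + β)) * (A + B) =
      (1 / (α + β)) * ((α + β + |α - β|) / 2 * (A + B)) := by
    field_simp
  rw [hrw]
  refine mul_le_mul_of_nonneg_left ?_ (by positivity)
  nlinarith [mul_le_mul_of_nonneg_right (le_abs_self (α - β)) hA,
    mul_le_mul_of_nonneg_right (neg_abs_le (α - β)) hB]

/-- **Cerone's inequality, `L_1` case.** If `f` is absolutely continuous on `[a,b]`
(expressed via the fundamental theorem of calculus with integrable density `f'`),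
`α, β ≥ 0` with `α + β > 0`, and `x ∈ (a,b)`, then
`|f(x) − (1/(α+β))·(α·M(f;a,x) + β·M(f;x,b))| ≤ (1/2)·(1 + |α−β|/(α+β))·‖f'‖_1`. -/
theorem cerone_L1 (a b : ℝ) (hab : a < b) (f f' : ℝ → ℝ) (α β : ℝ)
    (hα : 0 ≤ α) (hβ : 0 ≤ β) (hαβ : 0 < α + β)
    (hf'int : IntervalIntegrable f' volume a b)
    (hftc : ∀ y ∈ Set.Icc a b, f y = f a + ∫ t in a..y, f' t)
    (x : ℝ) (hx : x ∈ Set.Ioo a b) :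
    |f x - (1 / (α + β)) * (α * ((1 / (x - a)) * ∫ t in a..x, f t) +
        β * ((1 / (b - x)) * ∫ t in x..b, f t))| ≤
      (1 / 2) * (1 + |α - β| / (α + β)) * ∫ t in a..b, |f' t| := by
  obtain ⟨hax, hxb⟩ := hx
  have hxI : x ∈ Set.Icc a b := ⟨hax.le, hxb.le⟩
  have hint : ∀ u ∈ Set.Icc a b, ∀ v ∈ Set.Icc a b, IntervalIntegrable f' volume u v :=
    fun u hu v hv => hf'int.mono_set (by
      rw [Set.uIcc_of_le hab.le]
      exact Set.uIcc_subset_Icc hu hv)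
  have haI : a ∈ Set.Icc a b := Set.left_mem_Icc.2 hab.le
  have hbI : b ∈ Set.Icc a b := Set.right_mem_Icc.2 hab.le
  have hsub : ∀ u ∈ Set.Icc a b, ∀ v ∈ Set.Icc a b, f v - f u = ∫ t in u..v, f' t := by
    intro u hu v hv
    rw [hftc u hu, hftc v hv, ← integral_add_adjacent_intervals (hint a haI u hu) (hint u hu v hv)]
    ring
  have hcont : ContinuousOn f (Set.Icc a b) := by
    have hprim : ContinuousOn (fun y => ∫ t in a..y, f' t) (Set.uIcc a b) :=
      continuousOn_primitive_interval' hf'int Set.left_mem_uIcc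
    rw [Set.uIcc_of_le hab.le] at hprim
    exact (continuousOn_const.add hprim).congr hftc
  have hfint : ∀ u ∈ Set.Icc a b, ∀ v ∈ Set.Icc a b, IntervalIntegrable f volume u v :=
    fun u hu v hv => (hcont.mono (Set.uIcc_subset_Icc hu hv)).intervalIntegrable
  have hosc : ∀ c ∈ Set.Icc a b, ∀ d ∈ Set.Icc a b, ∀ u ∈ Set.Icc c d, ∀ v ∈ Set.Icc u d,
      |f v - f u| ≤ ∫ t in c..d, |f' t| := by
    intro c hc d hd u hu v hv
    rw [hsub u ⟨hc.1.trans hu.1, hu.2.trans hd.2⟩ v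
      ⟨(hc.1.trans hu.1).trans hv.1, hv.2.trans hd.2⟩]
    exact (abs_integral_le_integral_abs hv.1).trans
      (integral_mono_interval hu.1 hv.1 hv.2 (Filter.Eventually.of_forall fun t => abs_nonneg _)
        (hint c hc d hd).abs)
  have hleft : |f x - (1 / (x - a)) * ∫ t in a..x, f t| ≤ ∫ t in a..x, |f' t| :=
    abs_sub_intervalMean_le hax (hfint a haI x hxI) fun t ht =>
      hosc a haI x hxI t ht x ⟨ht.2, le_rfl⟩
  have hright : |f x - (1 / (b - x)) * ∫ t in x..b, f t| ≤ ∫ t in x..b, |f' t| :=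
    abs_sub_intervalMean_le hxb (hfint x hxI b hbI) fun t ht => by
      rw [abs_sub_comm]
      exact hosc x hxI b hbI x ⟨le_rfl, hxb.le⟩ t ht
  rw [← integral_add_adjacent_intervals (hint a haI x hxI).abs (hint x hxI b hbI).abs]
  refine le_trans ?_ (weighted_average_le_add hαβ
    ((abs_nonneg _).trans hleft) ((abs_nonneg _).trans hright))
  generalize (1 / (x - a)) * ∫ t in a..x, f t = m at hleft ⊢
  generalize (1 / (b - x)) * ∫ t in x..b, f t = n at hright ⊢
  have hrw : f x - (1 / (α + β)) * (α * m + β * n) =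
      (1 / (α + β)) * (α * (f x - m) + β * (f x - n)) := by
    field_simp
    ring
  rw [hrw, abs_mul, abs_of_pos (one_div_pos.2 hαβ)]
  refine mul_le_mul_of_nonneg_left ((abs_add_le _ _).trans ?_) (one_div_pos.2 hαβ).le
  rw [abs_mul, abs_mul, abs_of_nonneg hα, abs_of_nonneg hβ]
  gcongr
end

section
/- Let f : [a,b] → ℝ be absolutely continuous, let w : [a,b] → [0,∞) be integrable, let α, β ≥ 0 with α + β > 0, and let x ∈ (a,b) be such that m(a,x) > 0 and m(x,b) > 0. Define the weighted Peano kernel ρ(x,t) = (α/(α+β))·m(a,t)/m(a,x) for a ≤ t ≤ x and ρ(x,t) = −(β/(α+β))·m(t,b)/m(x,b) for x < t ≤ b. Then ∫_a^b ρ(x,t) f'(t) dt = f(x) − (1/(α+β))·[α·N(a,x)/m(a,x) + β·N(x,b)/m(x,b)]. -/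
open MeasureTheory intervalIntegral

/-- Integration by parts for indefinite integrals of integrable functions. -/
theorem integral_mul_eq_sub_of_eq_add_integral {F G f g : ℝ → ℝ} {c d : ℝ}
    (hf : IntervalIntegrable f volume c d) (hg : IntervalIntegrable g volume c d)
    (hF : ∀ y ∈ Set.uIcc c d, F y = F c + ∫ t in c..y, f t)
    (hG : ∀ y ∈ Set.uIcc c d, G y = G c + ∫ t in c..y, g t) :
    ∫ t in c..d, G t * f t = G d * F d - G c * F c - ∫ t in c..d, g t * F t := by
  have hfac := hf.absolutelyContinuousOnInterval_intervalIntegral Set.left_mem_uIcc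
  have hgac := hg.absolutelyContinuousOnInterval_intervalIntegral Set.left_mem_uIcc
  have hP : ContinuousOn (fun y => ∫ t in c..y, f t) (Set.uIcc c d) := hfac.continuousOn
  have hQ : ContinuousOn (fun y => ∫ t in c..y, g t) (Set.uIcc c d) := hgac.continuousOn
  have hparts : ∫ t in c..d, (∫ u in c..t, g u) * f t =
      (∫ t in c..d, g t) * (∫ t in c..d, f t) - ∫ t in c..d, g t * ∫ u in c..t, f u := by
    have h := hgac.integral_mul_deriv_eq_deriv_mul hfac
    rw [integral_same, zero_mul, sub_zero] at h
    convert h using 1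
    · refine intervalIntegral.integral_congr_ae ?_
      filter_upwards [hf.ae_hasDerivAt_integral] with t ht htm
      rw [(ht (Set.uIoc_subset_uIcc htm) c Set.left_mem_uIcc).deriv]
    · congr 1
      refine intervalIntegral.integral_congr_ae ?_
      filter_upwards [hg.ae_hasDerivAt_integral] with t ht htm
      rw [(ht (Set.uIoc_subset_uIcc htm) c Set.left_mem_uIcc).deriv]
  have hleft : ∫ t in c..d, G t * f t =
      G c * (∫ t in c..d, f t) + ∫ t in c..d, (∫ u in c..t, g u) * f t := by
    rw [← intervalIntegral.integral_const_mul,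
      ← integral_add (hf.const_mul _) (hf.continuousOn_mul hQ)]
    refine integral_congr fun t ht => ?_
    simp only [hG t ht, add_mul]
  have hright : ∫ t in c..d, g t * F t =
      F c * (∫ t in c..d, g t) + ∫ t in c..d, g t * ∫ u in c..t, f u := by
    rw [← intervalIntegral.integral_const_mul,
      ← integral_add (hg.const_mul _) (hg.mul_continuousOn hP)]
    refine integral_congr fun t ht => ?_
    simp only [hF t ht, mul_add, mul_comm]
  rw [hleft, hright, hparts, hF d Set.right_mem_uIcc, hG d Set.right_mem_uIcc]
  ring

/-- **Weighted Montgomery-type identity** (Lemma 1). For an absolutely continuous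
`f : [a,b] → ℝ` (expressed via the fundamental theorem of calculus with integrable
density `f'`), an integrable weight `w ≥ 0`, nonnegative `α, β` with `α + β > 0`, and
`x ∈ (a,b)` with `m(a,x) > 0` and `m(x,b) > 0`, the weighted Peano kernel
`ρ(x,t) = (α/(α+β))·m(a,t)/m(a,x)` for `a ≤ t ≤ x` and
`ρ(x,t) = −(β/(α+β))·m(t,b)/m(x,b)` for `x < t ≤ b` satisfies
`∫_a^b ρ(x,t)f'(t)dt = f(x) − (1/(α+β))·(α·N(a,x)/m(a,x) + β·N(x,b)/m(x,b))`. -/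
theorem weighted_peano_identity (a b : ℝ) (hab : a < b) (f f' w : ℝ → ℝ) (α β : ℝ)
    (hα : 0 ≤ α) (hβ : 0 ≤ β) (hαβ : 0 < α + β)
    (hw_int : IntervalIntegrable w volume a b)
    (hw_nonneg : ∀ t ∈ Set.Icc a b, 0 ≤ w t)
    (hf'int : IntervalIntegrable f' volume a b)
    (hftc : ∀ y ∈ Set.Icc a b, f y = f a + ∫ t in a..y, f' t)
    (x : ℝ) (hx : x ∈ Set.Ioo a b)
    (hmax : 0 < ∫ t in a..x, w t) (hmxb : 0 < ∫ t in x..b, w t) :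
    (∫ t in a..b,
        (if t ≤ x then (α / (α + β)) * (∫ u in a..t, w u) / (∫ u in a..x, w u)
          else -((β / (α + β)) * (∫ u in t..b, w u) / (∫ u in x..b, w u))) * f' t) =
      f x - (1 / (α + β)) *
        (α * (∫ t in a..x, f t * w t) / (∫ t in a..x, w t) +
          β * (∫ t in x..b, f t * w t) / (∫ t in x..b, w t)) := by
  have hsub₁ : Set.uIcc a x ⊆ Set.uIcc a b :=
    Set.uIcc_subset_uIcc_left (Set.Icc_subset_uIcc (Set.Ioo_subset_Icc_self hx))
  have hsub₂ : Set.uIcc x b ⊆ Set.uIcc a b :=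
    Set.uIcc_subset_uIcc_right (Set.Icc_subset_uIcc (Set.Ioo_subset_Icc_self hx))
  have hw₁ := hw_int.mono_set hsub₁
  have hw₂ := hw_int.mono_set hsub₂
  have hf₁ := hf'int.mono_set hsub₁
  have hf₂ := hf'int.mono_set hsub₂
  rw [Set.uIcc_of_le hab.le] at hsub₁ hsub₂
  have hcont₁ : ContinuousOn (fun t => ∫ u in a..t, w u) (Set.uIcc a x) :=
    (hw₁.absolutelyContinuousOnInterval_intervalIntegral Set.left_mem_uIcc).continuousOn
  have hcont₂ : ContinuousOn (fun t => ∫ u in t..b, w u) (Set.uIcc x b) := by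
    simp only [integral_symm b]
    exact (hw₂.absolutelyContinuousOnInterval_intervalIntegral
      Set.right_mem_uIcc).continuousOn.neg
  have hw_tail : ∀ y ∈ Set.uIcc x b,
      (∫ u in y..b, w u) = (∫ u in x..b, w u) + ∫ u in x..y, -w u := fun y hy => by
    rw [intervalIntegral.integral_neg, ← integral_add_adjacent_intervals
      (hw₂.mono_set (Set.uIcc_subset_uIcc_left hy)) (hw₂.mono_set (Set.uIcc_subset_uIcc_right hy))]
    ring
  have hf_right : ∀ y ∈ Set.uIcc x b, f y = f x + ∫ t in x..y, f' t := fun y hy => by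
    rw [hftc y (hsub₂ hy), hftc x (Set.Ioo_subset_Icc_self hx), add_assoc,
      integral_add_adjacent_intervals hf₁ (hf₂.mono_set (Set.uIcc_subset_uIcc_left hy))]
  have hparts₁ := integral_mul_eq_sub_of_eq_add_integral (G := fun t => ∫ u in a..t, w u) hf₁ hw₁
    (fun y hy => hftc y (hsub₁ hy)) (fun y _ => by simp)
  have hparts₂ := integral_mul_eq_sub_of_eq_add_integral (G := fun t => ∫ u in t..b, w u)
    hf₂ hw₂.neg hf_right hw_tail
  set ρ : ℝ → ℝ := fun t =>
    (if t ≤ x then (α / (α + β)) * (∫ u in a..t, w u) / (∫ u in a..x, w u)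
      else -((β / (α + β)) * (∫ u in t..b, w u) / (∫ u in x..b, w u))) * f' t with hρ
  have heq₁ : Set.EqOn (fun t => α / (α + β) / (∫ u in a..x, w u) * ((∫ u in a..t, w u) * f' t))
      ρ (Set.uIoc a x) := fun t ht => by
    rw [Set.uIoc_of_le hx.1.le] at ht
    simp only [hρ, if_pos ht.2]
    ring
  have heq₂ : Set.EqOn
      (fun t => -(β / (α + β) / (∫ u in x..b, w u)) * ((∫ u in t..b, w u) * f' t))
      ρ (Set.uIoc x b) := fun t ht => by
    rw [Set.uIoc_of_le hx.2.le] at ht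
    simp only [hρ, if_neg ht.1.not_ge]
    ring
  have hint₁ : IntervalIntegrable ρ volume a x :=
    ((hf₁.continuousOn_mul hcont₁).const_mul _).congr heq₁
  have hint₂ : IntervalIntegrable ρ volume x b :=
    ((hf₂.continuousOn_mul hcont₂).const_mul _).congr heq₂
  rw [← integral_add_adjacent_intervals hint₁ hint₂,
    ← intervalIntegral.integral_congr_ae (.of_forall heq₁),
    ← intervalIntegral.integral_congr_ae (.of_forall heq₂),
    intervalIntegral.integral_const_mul, intervalIntegral.integral_const_mul, hparts₁, hparts₂]
  simp only [integral_same, zero_mul, Pi.neg_apply, neg_mul, intervalIntegral.integral_neg,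
    mul_comm (w _)]
  have := hαβ.ne'
  have := hmax.ne'
  have := hmxb.ne'
  field_simp
  ring
end

section
/- Let f : [a,b] → ℝ be absolutely continuous with f' essentially bounded, let w : [a,b] → [0,∞) be integrable, let α, β ≥ 0 with α + β > 0, and let x ∈ (a,b) be such that m(a,x) > 0, m(x,b) > 0, and w(u) ≤ w(x) for almost every u ∈ [a,b]. Then |f(x) − (1/(α+β))·[α·M(f,w;a,x) + β·M(f,w;x,b)]| ≤ (1/(2(α+β)))·[α·(x−a)²/m(a,x) + β·(b−x)²/m(x,b)]·w(x)·‖f'‖_∞. -/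
open MeasureTheory intervalIntegral

/-- A function whose increments on `[a, b]` are integrals of a density bounded almost everywhere
by `M` is `M`-Lipschitz on `[a, b]`. -/
theorem abs_sub_le_of_eq_integral {a b M : ℝ} {f f' : ℝ → ℝ}
    (hf'int : IntervalIntegrable f' volume a b)
    (hftc : ∀ y ∈ Set.Icc a b, f y = f a + ∫ t in a..y, f' t)
    (hM : ∀ᵐ t ∂(volume.restrict (Set.Icc a b)), |f' t| ≤ M)
    {y z : ℝ} (hy : y ∈ Set.Icc a b) (hz : z ∈ Set.Icc a b) :
    |f y - f z| ≤ M * |y - z| := by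
  have hab : a ≤ b := hy.1.trans hy.2
  have hint : ∀ c ∈ Set.Icc a b, IntervalIntegrable f' volume a c := fun c hc ↦
    hf'int.mono_set (by
      rw [Set.uIcc_of_le hc.1, Set.uIcc_of_le hab]
      exact Set.Icc_subset_Icc_right hc.2)
  have hsub : f y - f z = ∫ t in z..y, f' t := by
    rw [hftc y hy, hftc z hz, add_sub_add_left_eq_sub,
      integral_interval_sub_left (hint y hy) (hint z hz)]
  rw [hsub, ← Real.norm_eq_abs]
  refine norm_integral_le_of_norm_le_const_ae ?_
  filter_upwards [(ae_restrict_iff' measurableSet_Icc).1 hM] with t ht htm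
  exact ht (Set.uIcc_subset_Icc hz hy (Set.uIoc_subset_uIcc htm))

/-- A weighted mean of a function that is Lipschitz at `x` differs from the value at `x` by at most
the Lipschitz constant times the weighted mean of the distance to `x`, with the weight in the
numerator replaced by an upper bound `C`. -/
theorem abs_sub_weighted_mean_le {p q x M C : ℝ} {f w : ℝ → ℝ} (hpq : p ≤ q)
    (hf : ContinuousOn f (Set.Icc p q)) (hw : IntervalIntegrable w volume p q)
    (hlip : ∀ t ∈ Set.Icc p q, |f x - f t| ≤ M * |x - t|) (hM : 0 ≤ M)
    (hw_bound : ∀ᵐ t ∂(volume.restrict (Set.Icc p q)), 0 ≤ w t ∧ w t ≤ C)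
    (hm : 0 < ∫ t in p..q, w t) :
    |f x - (∫ t in p..q, f t * w t) / (∫ t in p..q, w t)| ≤
      M * C * (∫ t in p..q, |x - t|) / (∫ t in p..q, w t) := by
  have hfw : IntervalIntegrable (fun t ↦ f t * w t) volume p q :=
    hw.continuousOn_mul (by rwa [Set.uIcc_of_le hpq])
  have hnum : f x * (∫ t in p..q, w t) - (∫ t in p..q, f t * w t) =
      ∫ t in p..q, (f x - f t) * w t := by
    rw [← intervalIntegral.integral_const_mul, ← intervalIntegral.integral_sub (hw.const_mul _) hfw]
    simp only [sub_mul]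
  have hbound : |∫ t in p..q, (f x - f t) * w t| ≤ ∫ t in p..q, M * C * |x - t| := by
    have hcont : Continuous fun t ↦ M * C * |x - t| := by fun_prop
    rw [← Real.norm_eq_abs]
    refine intervalIntegral.norm_integral_le_of_norm_le hpq ?_ (hcont.intervalIntegrable p q)
    filter_upwards [(ae_restrict_iff' measurableSet_Icc).1 hw_bound] with t ht htm
    have htm' := Set.Ioc_subset_Icc_self htm
    obtain ⟨h0, hC⟩ := ht htm'
    calc ‖(f x - f t) * w t‖ = |f x - f t| * w t := by
          rw [Real.norm_eq_abs, abs_mul, abs_of_nonneg h0]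
      _ ≤ M * |x - t| * C := by
          gcongr
          exact hlip t htm'
      _ = M * C * |x - t| := by ring
  rw [intervalIntegral.integral_const_mul] at hbound
  rw [sub_div' hm.ne', hnum, abs_div, abs_of_pos hm]
  gcongr

theorem integral_abs_sub_right_endpoint {p q : ℝ} (hpq : p ≤ q) :
    ∫ t in p..q, |q - t| = (q - p) ^ 2 / 2 := by
  have : ∫ t in p..q, |q - t| = ∫ t in p..q, (q - t) :=
    integral_congr fun t ht ↦ abs_of_nonneg (by
      rw [Set.uIcc_of_le hpq] at ht
      linarith [ht.2])
  rw [this, integral_comp_sub_left (fun t ↦ t)]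
  simp

theorem integral_abs_sub_left_endpoint {p q : ℝ} (hpq : p ≤ q) :
    ∫ t in p..q, |p - t| = (q - p) ^ 2 / 2 := by
  have : ∫ t in p..q, |p - t| = ∫ t in p..q, (t - p) :=
    integral_congr fun t ht ↦ by
      rw [Set.uIcc_of_le hpq] at ht
      rw [abs_sub_comm]
      exact abs_of_nonneg (by linarith [ht.1])
  rw [this, integral_comp_sub_right (fun t ↦ t)]
  simp

/-- **Weighted Ostrowski-type inequality, `L_∞` case** (Theorem 3, first bound). If `f` is
absolutely continuous on `[a,b]` (expressed via the fundamental theorem of calculus with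
integrable density `f'`), `f'` is essentially bounded by `M` on `[a,b]`, `w ≥ 0` is an
integrable weight, `α, β ≥ 0` with `α + β > 0`, and `x ∈ (a,b)` satisfies `m(a,x) > 0`,
`m(x,b) > 0` and `w(u) ≤ w(x)` for a.e. `u ∈ [a,b]`, then
`|f(x) − (1/(α+β))·(α·M(f,w;a,x) + β·M(f,w;x,b))|
  ≤ (1/(2(α+β)))·(α(x−a)²/m(a,x) + β(b−x)²/m(x,b))·w(x)·M`. -/
theorem weighted_ostrowski_Linfty (a b : ℝ) (hab : a < b) (f f' w : ℝ → ℝ) (M α β : ℝ)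
    (hα : 0 ≤ α) (hβ : 0 ≤ β) (hαβ : 0 < α + β)
    (hw_int : IntervalIntegrable w volume a b)
    (hw_nonneg : ∀ t ∈ Set.Icc a b, 0 ≤ w t)
    (hf'int : IntervalIntegrable f' volume a b)
    (hftc : ∀ y ∈ Set.Icc a b, f y = f a + ∫ t in a..y, f' t)
    (hM : ∀ᵐ t ∂(volume.restrict (Set.Icc a b)), |f' t| ≤ M)
    (x : ℝ) (hx : x ∈ Set.Ioo a b)
    (hmax : 0 < ∫ t in a..x, w t) (hmxb : 0 < ∫ t in x..b, w t)
    (hw_le : ∀ᵐ u ∂(volume.restrict (Set.Icc a b)), w u ≤ w x) :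
    |f x - (1 / (α + β)) *
        (α * ((∫ t in a..x, f t * w t) / (∫ t in a..x, w t)) +
          β * ((∫ t in x..b, f t * w t) / (∫ t in x..b, w t)))| ≤
      (1 / (2 * (α + β))) *
        (α * (x - a) ^ 2 / (∫ t in a..x, w t) + β * (b - x) ^ 2 / (∫ t in x..b, w t)) *
        w x * M := by
  have hxI := Set.Ioo_subset_Icc_self hx
  have hlip : ∀ y ∈ Set.Icc a b, ∀ z ∈ Set.Icc a b, |f y - f z| ≤ M * |y - z| :=
    fun y hy z hz ↦ abs_sub_le_of_eq_integral hf'int hftc hM hy hz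
  have hM0 : 0 ≤ M := by
    have h := (abs_nonneg _).trans
      (hlip b (Set.right_mem_Icc.2 hab.le) a (Set.left_mem_Icc.2 hab.le))
    exact nonneg_of_mul_nonneg_left h (abs_pos.2 (sub_ne_zero.2 hab.ne'))
  have hcont : ContinuousOn f (Set.Icc a b) :=
    (LipschitzOnWith.of_dist_le_mul (K := ⟨M, hM0⟩) hlip).continuousOn
  have hw_bound : ∀ᵐ t ∂(volume.restrict (Set.Icc a b)), 0 ≤ w t ∧ w t ≤ w x := by
    filter_upwards [hw_le, ae_restrict_mem measurableSet_Icc] with t ht htm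
    exact ⟨hw_nonneg t htm, ht⟩
  have hmean : ∀ {p q : ℝ}, p ≤ q → Set.Icc p q ⊆ Set.Icc a b → 0 < ∫ t in p..q, w t →
      |f x - (∫ t in p..q, f t * w t) / (∫ t in p..q, w t)| ≤
        M * w x * (∫ t in p..q, |x - t|) / (∫ t in p..q, w t) := fun hpq hsub hm ↦
    abs_sub_weighted_mean_le hpq (hcont.mono hsub)
      (hw_int.mono_set (by rwa [Set.uIcc_of_le hpq, Set.uIcc_of_le hab.le]))
      (fun t ht ↦ hlip x hxI t (hsub ht)) hM0
      (ae_restrict_of_ae_restrict_of_subset hsub hw_bound) hm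
  have hleft := hmean hx.1.le (Set.Icc_subset_Icc_right hx.2.le) hmax
  have hright := hmean hx.2.le (Set.Icc_subset_Icc_left hx.1.le) hmxb
  rw [integral_abs_sub_right_endpoint hx.1.le] at hleft
  rw [integral_abs_sub_left_endpoint hx.2.le] at hright
  set A := (∫ t in a..x, f t * w t) / (∫ t in a..x, w t)
  set B := (∫ t in x..b, f t * w t) / (∫ t in x..b, w t)
  have hsplit : f x - 1 / (α + β) * (α * A + β * B) =
      1 / (α + β) * (α * (f x - A) + β * (f x - B)) := by
    field_simp
    ring
  rw [hsplit, abs_mul, abs_of_pos (one_div_pos.2 hαβ)]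
  calc 1 / (α + β) * |α * (f x - A) + β * (f x - B)|
      ≤ 1 / (α + β) * (α * |f x - A| + β * |f x - B|) := by
        gcongr
        refine (abs_add_le _ _).trans_eq ?_
        rw [abs_mul, abs_mul, abs_of_nonneg hα, abs_of_nonneg hβ]
    _ ≤ 1 / (α + β) * (α * (M * w x * ((x - a) ^ 2 / 2) / (∫ t in a..x, w t)) +
          β * (M * w x * ((b - x) ^ 2 / 2) / (∫ t in x..b, w t))) := by
        gcongr
    _ = _ := by
        field_simp
end

section
/- Let f : [a,b] → ℝ be absolutely continuous with f' ∈ L_p[a,b], where p > 1 and 1/p + 1/q = 1, let w : [a,b] → [0,∞) be integrable, let α, β ≥ 0 with α + β > 0, and let x ∈ (a,b) be such that m(a,x) > 0, m(x,b) > 0, and w(u) ≤ w(x) for almost every u ∈ [a,b]. Then |f(x) − (1/(α+β))·[α·M(f,w;a,x) + β·M(f,w;x,b)]| ≤ (w(x)/((q+1)^{1/q}(α+β)))·[α^q·(x−a)^{q+1}/m(a,x)^q + β^q·(b−x)^{q+1}/m(x,b)^q]^{1/q}·‖f'‖_p. -/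
open MeasureTheory intervalIntegral

/-- Integration by parts for two indefinite integrals based at the same point. -/
theorem integral_integral_mul_eq_sub {g w : ℝ → ℝ} {c d : ℝ}
    (hg : IntervalIntegrable g volume c d) (hw : IntervalIntegrable w volume c d) :
    ∫ t in c..d, (∫ s in c..t, g s) * w t =
      (∫ t in c..d, g t) * (∫ t in c..d, w t) - ∫ t in c..d, (∫ s in c..t, w s) * g t := by
  have hG := hg.absolutelyContinuousOnInterval_intervalIntegral (c := c) Set.left_mem_uIcc
  have hW := hw.absolutelyContinuousOnInterval_intervalIntegral (c := c) Set.left_mem_uIcc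
  have key := hG.integral_mul_deriv_eq_deriv_mul hW
  have h1 : ∫ t in c..d, (∫ s in c..t, g s) * deriv (fun y => ∫ s in c..y, w s) t =
      ∫ t in c..d, (∫ s in c..t, g s) * w t := by
    refine integral_congr_ae ?_
    filter_upwards [hw.ae_hasDerivAt_integral] with t ht hmem
    rw [(ht (Set.uIoc_subset_uIcc hmem) c Set.left_mem_uIcc).deriv]
  have h2 : ∫ t in c..d, deriv (fun y => ∫ s in c..y, g s) t * (∫ s in c..t, w s) =
      ∫ t in c..d, (∫ s in c..t, w s) * g t := by
    refine integral_congr_ae ?_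
    filter_upwards [hg.ae_hasDerivAt_integral] with t ht hmem
    rw [(ht (Set.uIoc_subset_uIcc hmem) c Set.left_mem_uIcc).deriv, mul_comm]
  rw [h1, h2] at key
  simpa using key

/-- The weighted Montgomery identity on one side of the point `d`. -/
theorem mul_integral_sub_integral_mul_eq {f g w : ℝ → ℝ} {c d : ℝ}
    (hg : IntervalIntegrable g volume c d) (hw : IntervalIntegrable w volume c d)
    (hf : ∀ y ∈ Set.uIcc c d, f y = f c + ∫ t in c..y, g t) :
    f d * (∫ t in c..d, w t) - ∫ t in c..d, f t * w t =
      ∫ t in c..d, (∫ s in c..t, w s) * g t := by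
  have hG := (hg.absolutelyContinuousOnInterval_intervalIntegral (c := c)
    Set.left_mem_uIcc).continuousOn
  have h : ∫ t in c..d, f t * w t =
      f c * (∫ t in c..d, w t) + ∫ t in c..d, (∫ s in c..t, g s) * w t := by
    rw [← intervalIntegral.integral_const_mul,
      ← intervalIntegral.integral_add (hw.const_mul _) (hw.continuousOn_mul hG)]
    refine integral_congr fun t ht => ?_
    simp only [hf t ht]
    ring
  rw [h, integral_integral_mul_eq_sub hg hw, hf d Set.right_mem_uIcc]
  ring

theorem setIntegral_uIoc_abs_sub_rpow {c d q : ℝ} (hq : 0 ≤ q) :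
    ∫ t in Set.uIoc c d, |t - c| ^ q = |d - c| ^ (q + 1) / (q + 1) := by
  have h0 : ∀ z : ℝ, ∫ t in (0 : ℝ)..z, t ^ q = z ^ (q + 1) / (q + 1) := by
    intro z
    rw [integral_rpow (Or.inl (by linarith)), Real.zero_rpow (by linarith), sub_zero]
  rcases le_total c d with h | h
  · rw [Set.uIoc_of_le h, ← integral_of_le h, abs_of_nonneg (sub_nonneg.2 h),
      ← h0, ← sub_self c, ← integral_comp_sub_right (fun t => t ^ q)]
    refine integral_congr fun t ht => ?_
    rw [Set.uIcc_of_le h] at ht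
    simp only [abs_of_nonneg (sub_nonneg.2 ht.1)]
  · rw [Set.uIoc_of_ge h, ← integral_of_le h, abs_of_nonpos (sub_nonpos.2 h), neg_sub,
      ← h0, ← sub_self c, ← integral_comp_sub_left (fun t => t ^ q)]
    refine integral_congr fun t ht => ?_
    rw [Set.uIcc_of_le h] at ht
    simp only [abs_of_nonpos (sub_nonpos.2 ht.2), neg_sub]

/-- One-sided `L_p` estimate for the deviation of `f d` from a weighted mean of `f`. -/
theorem abs_mul_integral_sub_integral_mul_le {f g w : ℝ → ℝ} {c d p q K : ℝ}
    (hpq : p.HolderConjugate q)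
    (hg : IntervalIntegrable g volume c d) (hw : IntervalIntegrable w volume c d)
    (hgp : IntervalIntegrable (fun t => |g t| ^ p) volume c d)
    (hf : ∀ y ∈ Set.uIcc c d, f y = f c + ∫ t in c..y, g t) (hK : 0 ≤ K)
    (hwK : ∀ᵐ t, t ∈ Set.uIcc c d → |w t| ≤ K) :
    |f d * (∫ t in c..d, w t) - ∫ t in c..d, f t * w t| ≤
      K * ((|d - c| ^ (q + 1) / (q + 1)) ^ (1 / q) *
        (∫ t in Set.uIoc c d, |g t| ^ p) ^ (1 / p)) := by
  rw [mul_integral_sub_integral_mul_eq hg hw hf]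
  have hW : ∀ t ∈ Set.uIoc c d, |∫ s in c..t, w s| ≤ K * |t - c| := by
    intro t ht
    refine norm_integral_le_of_norm_le_const_ae (f := w) ?_
    filter_upwards [hwK] with s hs hmem
    exact hs (Set.uIcc_subset_uIcc_left (Set.uIoc_subset_uIcc ht) (Set.uIoc_subset_uIcc hmem))
  have hcont : Continuous fun t : ℝ => |t - c| := by fun_prop
  have hint : IntervalIntegrable (fun t => |t - c| * |g t|) volume c d :=
    hg.abs.continuousOn_mul hcont.continuousOn
  have hq0 := hpq.symm.pos
  have hm1 : MemLp (fun t => |t - c|) (ENNReal.ofReal q) (volume.restrict (Set.uIoc c d)) := by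
    have : IsFiniteMeasure (volume.restrict (Set.uIoc c d)) :=
      ⟨by simp [Set.uIoc]⟩
    refine memLp_of_bounded (a := 0) (b := |d - c|) ?_ hcont.aestronglyMeasurable _
    filter_upwards [ae_restrict_mem measurableSet_uIoc] with t ht
    exact ⟨abs_nonneg _, Set.abs_sub_left_of_mem_uIcc (Set.uIoc_subset_uIcc ht)⟩
  have hm2 : MemLp (fun t => |g t|) (ENNReal.ofReal p) (volume.restrict (Set.uIoc c d)) := by
    have hp0 := hpq.pos
    refine (integrable_norm_rpow_iff (hg.abs.def'.aestronglyMeasurable) (by simpa using hp0)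
      ENNReal.ofReal_ne_top).1 ?_
    simpa [ENNReal.toReal_ofReal hp0.le] using hgp.def'.integrable
  calc |∫ t in c..d, (∫ s in c..t, w s) * g t|
      ≤ ∫ t in Set.uIoc c d, K * (|t - c| * |g t|) := by
        rw [← Real.norm_eq_abs, norm_integral_eq_norm_integral_uIoc]
        refine norm_integral_le_of_norm_le (hint.def'.const_mul K) ?_
        filter_upwards [ae_restrict_mem measurableSet_uIoc] with t ht
        rw [norm_mul, Real.norm_eq_abs, Real.norm_eq_abs, ← mul_assoc]
        gcongr
        exact hW t ht
    _ = K * ∫ t in Set.uIoc c d, |t - c| * |g t| := integral_const_mul _ _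
    _ ≤ _ := by
        rw [← setIntegral_uIoc_abs_sub_rpow hq0.le]
        gcongr
        exact integral_mul_le_Lp_mul_Lq_of_nonneg hpq.symm
          (Filter.Eventually.of_forall fun _ => abs_nonneg _)
          (Filter.Eventually.of_forall fun _ => abs_nonneg _) hm1 hm2

/-- **Weighted Ostrowski-type inequality, `L_p` case** (Theorem 3, second bound). If `f` is
absolutely continuous on `[a,b]` (expressed via the fundamental theorem of calculus with
integrable density `f'`), `|f'|^p` is integrable where `p > 1`, `1/p + 1/q = 1`, `w ≥ 0`
is an integrable weight, `α, β ≥ 0` with `α + β > 0`, and `x ∈ (a,b)` satisfies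
`m(a,x) > 0`, `m(x,b) > 0` and `w(u) ≤ w(x)` for a.e. `u ∈ [a,b]`, then
`|f(x) − (1/(α+β))·(α·M(f,w;a,x) + β·M(f,w;x,b))|
  ≤ (w(x)/((q+1)^{1/q}(α+β)))·(α^q(x−a)^{q+1}/m(a,x)^q + β^q(b−x)^{q+1}/m(x,b)^q)^{1/q}·‖f'‖_p`. -/
theorem weighted_ostrowski_Lp (a b : ℝ) (hab : a < b) (f f' w : ℝ → ℝ) (p q α β : ℝ)
    (hp : 1 < p) (hpq : 1 / p + 1 / q = 1)
    (hα : 0 ≤ α) (hβ : 0 ≤ β) (hαβ : 0 < α + β)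
    (hw_int : IntervalIntegrable w volume a b)
    (hw_nonneg : ∀ t ∈ Set.Icc a b, 0 ≤ w t)
    (hf'int : IntervalIntegrable f' volume a b)
    (hf'Lp : IntervalIntegrable (fun t => |f' t| ^ p) volume a b)
    (hftc : ∀ y ∈ Set.Icc a b, f y = f a + ∫ t in a..y, f' t)
    (x : ℝ) (hx : x ∈ Set.Ioo a b)
    (hmax : 0 < ∫ t in a..x, w t) (hmxb : 0 < ∫ t in x..b, w t)
    (hw_le : ∀ᵐ u ∂(volume.restrict (Set.Icc a b)), w u ≤ w x) :
    |f x - (1 / (α + β)) *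
        (α * ((∫ t in a..x, f t * w t) / (∫ t in a..x, w t)) +
          β * ((∫ t in x..b, f t * w t) / (∫ t in x..b, w t)))| ≤
      (w x / ((q + 1) ^ (1 / q) * (α + β))) *
        (α ^ q * (x - a) ^ (q + 1) / (∫ t in a..x, w t) ^ q +
          β ^ q * (b - x) ^ (q + 1) / (∫ t in x..b, w t) ^ q) ^ (1 / q) *
        (∫ t in a..b, |f' t| ^ p) ^ (1 / p) := by
  have hconj : p.HolderConjugate q := by
    rw [Real.holderConjugate_iff]
    exact ⟨hp, by simpa using hpq⟩
  have hp0 := hconj.pos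
  have hq0 := hconj.symm.pos
  obtain ⟨hax, hxb⟩ := hx
  have hmem : x ∈ Set.uIcc a b := Set.uIcc_of_le hab.le ▸ ⟨hax.le, hxb.le⟩
  have hleft : Set.uIcc a x ⊆ Set.uIcc a b := Set.uIcc_subset_uIcc_left hmem
  have hright : Set.uIcc b x ⊆ Set.uIcc a b := by
    rw [Set.uIcc_comm b x]; exact Set.uIcc_subset_uIcc_right hmem
  have hK : 0 ≤ w x := hw_nonneg x ⟨hax.le, hxb.le⟩
  have hwK : ∀ᵐ t, t ∈ Set.uIcc a b → |w t| ≤ w x := by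
    rw [Set.uIcc_of_le hab.le]
    filter_upwards [(ae_restrict_iff' measurableSet_Icc).1 hw_le] with t ht hmt
    rw [abs_of_nonneg (hw_nonneg t hmt)]
    exact ht hmt
  have hL := abs_mul_integral_sub_integral_mul_le (f := f) hconj (hf'int.mono_set hleft)
    (hw_int.mono_set hleft) (hf'Lp.mono_set hleft)
    (fun y hy => hftc y (Set.uIcc_of_le hab.le ▸ hleft hy)) hK
    (hwK.mono fun t ht hmt => ht (hleft hmt))
  have hR := abs_mul_integral_sub_integral_mul_le (f := f) hconj (hf'int.mono_set hright)
    (hw_int.mono_set hright) (hf'Lp.mono_set hright)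
    (fun y hy => by
      have hy' := hright hy
      have hfy := hftc y (Set.uIcc_of_le hab.le ▸ hy')
      have hfb := hftc b ⟨hab.le, le_rfl⟩
      have hsum := integral_add_adjacent_intervals hf'int
        (hf'int.symm.mono_set (Set.uIcc_comm a b ▸ Set.uIcc_subset_uIcc Set.right_mem_uIcc hy'))
      linarith) hK
    (hwK.mono fun t ht hmt => ht (hright hmt))
  have hIP : (∫ t in Set.uIoc a x, |f' t| ^ p) + (∫ t in Set.uIoc b x, |f' t| ^ p) =
      ∫ t in a..b, |f' t| ^ p := by
    rw [← integral_add_adjacent_intervals (hf'Lp.mono_set hleft) (hf'Lp.mono_set hright).symm,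
      Set.uIoc_of_le hax.le, Set.uIoc_of_ge hxb.le, integral_of_le hax.le, integral_of_le hxb.le]
  rw [abs_of_pos (sub_pos.2 hax)] at hL
  rw [abs_of_neg (sub_neg.2 hxb), neg_sub, integral_symm x b, integral_symm x b,
    show ∀ u v : ℝ, u * -v - -(∫ t in x..b, f t * w t) =
      -(u * v - ∫ t in x..b, f t * w t) by intros; ring, abs_neg] at hR
  have hI1 : 0 ≤ ∫ t in Set.uIoc a x, |f' t| ^ p := integral_nonneg fun _ => by positivity
  have hI2 : 0 ≤ ∫ t in Set.uIoc b x, |f' t| ^ p := integral_nonneg fun _ => by positivity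
  have hxa : 0 < x - a := sub_pos.2 hax
  have hbx : 0 < b - x := sub_pos.2 hxb
  rw [← hIP]
  generalize (∫ t in Set.uIoc a x, |f' t| ^ p) = I₁ at *
  generalize (∫ t in Set.uIoc b x, |f' t| ^ p) = I₂ at *
  generalize (∫ t in a..x, f t * w t) = A at *
  generalize (∫ t in x..b, f t * w t) = B at *
  generalize (∫ t in a..x, w t) = m at *
  generalize (∫ t in x..b, w t) = n at *
  generalize x - a = r at *
  generalize b - x = s at *
  have hroot : ∀ γ ρ μ : ℝ, 0 ≤ γ → 0 < ρ → 0 < μ →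
      (γ / μ * (ρ ^ (q + 1) / (q + 1)) ^ (1 / q)) ^ q =
        γ ^ q * ρ ^ (q + 1) / μ ^ q / (q + 1) := by
    intro γ ρ μ hγ hρ hμ
    rw [Real.mul_rpow (by positivity) (by positivity), ← Real.rpow_mul (by positivity),
      one_div_mul_cancel hq0.ne', Real.rpow_one, Real.div_rpow hγ hμ.le]
    field_simp
  have hpow : ∀ J : ℝ, 0 ≤ J → (J ^ (1 / p)) ^ p = J := by
    intro J hJ
    rw [← Real.rpow_mul hJ, one_div_mul_cancel hp0.ne', Real.rpow_one]
  have holder : α / m * (r ^ (q + 1) / (q + 1)) ^ (1 / q) * I₁ ^ (1 / p) +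
      β / n * (s ^ (q + 1) / (q + 1)) ^ (1 / q) * I₂ ^ (1 / p) ≤
      ((α ^ q * r ^ (q + 1) / m ^ q + β ^ q * s ^ (q + 1) / n ^ q) / (q + 1)) ^ (1 / q) *
        (I₁ + I₂) ^ (1 / p) := by
    have := Real.inner_le_Lp_mul_Lq_of_nonneg (Finset.univ : Finset (Fin 2))
      (f := ![α / m * (r ^ (q + 1) / (q + 1)) ^ (1 / q), β / n * (s ^ (q + 1) / (q + 1)) ^ (1 / q)])
      (g := ![I₁ ^ (1 / p), I₂ ^ (1 / p)]) hconj.symm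
      (by
        intro i _
        fin_cases i <;> simp <;> positivity)
      (by
        intro i _
        fin_cases i <;> simp <;> positivity)
    simp only [Fin.sum_univ_two, Matrix.cons_val_zero, Matrix.cons_val_one] at this
    rwa [hroot _ _ _ hα hxa hmax, hroot _ _ _ hβ hbx hmxb, hpow _ hI1, hpow _ hI2,
      ← add_div] at this
  have hsplit : f x - (1 / (α + β)) * (α * (A / m) + β * (B / n)) =
      (α / m * (f x * m - A) + β / n * (f x * n - B)) / (α + β) := by
    field_simp
    ring
  rw [hsplit, abs_div, abs_of_pos hαβ, div_le_iff₀ hαβ]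
  calc |α / m * (f x * m - A) + β / n * (f x * n - B)|
      ≤ α / m * |f x * m - A| + β / n * |f x * n - B| := by
        refine (abs_add_le _ _).trans_eq ?_
        rw [abs_mul, abs_mul, abs_of_nonneg (div_nonneg hα hmax.le),
          abs_of_nonneg (div_nonneg hβ hmxb.le)]
    _ ≤ α / m * (w x * ((r ^ (q + 1) / (q + 1)) ^ (1 / q) * I₁ ^ (1 / p))) +
        β / n * (w x * ((s ^ (q + 1) / (q + 1)) ^ (1 / q) * I₂ ^ (1 / p))) := by gcongr
    _ = w x * (α / m * (r ^ (q + 1) / (q + 1)) ^ (1 / q) * I₁ ^ (1 / p) +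
        β / n * (s ^ (q + 1) / (q + 1)) ^ (1 / q) * I₂ ^ (1 / p)) := by ring
    _ ≤ w x * (((α ^ q * r ^ (q + 1) / m ^ q + β ^ q * s ^ (q + 1) / n ^ q) / (q + 1)) ^ (1 / q) *
        (I₁ + I₂) ^ (1 / p)) := by gcongr
    _ = _ := by
        rw [Real.div_rpow (by positivity) (by positivity)]
        field_simp
end

section
/- Let f : [a,b] → ℝ be absolutely continuous, let w : [a,b] → [0,∞) be integrable, let α, β ≥ 0 with α + β > 0, and let x ∈ (a,b) be such that m(a,x) > 0 and m(x,b) > 0. Then |f(x) − (1/(α+β))·[α·M(f,w;a,x) + β·M(f,w;x,b)]| ≤ (1/2)·(1 + |α−β|/(α+β))·‖f'‖_1. -/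
open MeasureTheory intervalIntegral

theorem abs_sub_weighted_mean_le_s9 {c d K y : ℝ} {f w : ℝ → ℝ} (hcd : c ≤ d)
    (hf : ContinuousOn f (Set.Icc c d)) (hw : IntervalIntegrable w volume c d)
    (hw_nonneg : ∀ t ∈ Set.Icc c d, 0 ≤ w t) (hpos : 0 < ∫ t in c..d, w t)
    (hK : ∀ t ∈ Set.Icc c d, |y - f t| ≤ K) :
    |y - (∫ t in c..d, f t * w t) / ∫ t in c..d, w t| ≤ K := by
  have hfw : IntervalIntegrable (fun t => f t * w t) volume c d :=
    hw.continuousOn_mul (by rwa [Set.uIcc_of_le hcd])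
  have hlow : ∫ t in c..d, (y - K) * w t ≤ ∫ t in c..d, f t * w t :=
    integral_mono_on hcd (hw.const_mul _) hfw fun t ht =>
      mul_le_mul_of_nonneg_right (by linarith [(abs_le.mp (hK t ht)).2]) (hw_nonneg t ht)
  have hupp : ∫ t in c..d, f t * w t ≤ ∫ t in c..d, (y + K) * w t :=
    integral_mono_on hcd hfw (hw.const_mul _) fun t ht =>
      mul_le_mul_of_nonneg_right (by linarith [(abs_le.mp (hK t ht)).1]) (hw_nonneg t ht)
  rw [intervalIntegral.integral_const_mul] at hlow hupp
  have h₁ := (le_div_iff₀ hpos).mpr hlow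
  have h₂ := (div_le_iff₀ hpos).mpr hupp
  exact abs_le.mpr ⟨by linarith, by linarith⟩

theorem abs_sub_le_integral_abs_of_eq_integral {a b c d s t : ℝ} {f f' : ℝ → ℝ}
    (hf' : IntervalIntegrable f' volume a b)
    (hftc : ∀ y ∈ Set.Icc a b, f y = f a + ∫ t in a..y, f' t)
    (hac : a ≤ c) (hdb : d ≤ b) (hcs : c ≤ s) (hst : s ≤ t) (htd : t ≤ d) :
    |f t - f s| ≤ ∫ u in c..d, |f' u| := by
  have hint : ∀ p q, a ≤ p → p ≤ q → q ≤ b → IntervalIntegrable f' volume p q :=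
    fun p q hp hpq hq => hf'.mono_set <| by
      rw [Set.uIcc_of_le hpq, Set.uIcc_of_le (hp.trans (hpq.trans hq))]
      exact Set.Icc_subset_Icc hp hq
  rw [hftc t ⟨by linarith, by linarith⟩, hftc s ⟨by linarith, by linarith⟩, add_sub_add_left_eq_sub,
    integral_interval_sub_left (hint a t le_rfl (by linarith) (by linarith))
      (hint a s le_rfl (by linarith) (by linarith))]
  refine (abs_integral_le_integral_abs hst).trans ?_
  exact integral_mono_interval hcs hst htd (Filter.Eventually.of_forall fun _ => abs_nonneg _)
    (hint c d hac (by linarith) hdb).abs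

/-- **Weighted Ostrowski-type inequality, `L_1` case** (Theorem 3, third bound). If `f` is
absolutely continuous on `[a,b]` (expressed via the fundamental theorem of calculus with
integrable density `f'`), `w ≥ 0` is an integrable weight, `α, β ≥ 0` with `α + β > 0`,
and `x ∈ (a,b)` satisfies `m(a,x) > 0` and `m(x,b) > 0`, then
`|f(x) − (1/(α+β))·(α·M(f,w;a,x) + β·M(f,w;x,b))| ≤ (1/2)·(1 + |α−β|/(α+β))·‖f'‖_1`. -/
theorem weighted_ostrowski_L1 (a b : ℝ) (hab : a < b) (f f' w : ℝ → ℝ) (α β : ℝ)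
    (hα : 0 ≤ α) (hβ : 0 ≤ β) (hαβ : 0 < α + β)
    (hw_int : IntervalIntegrable w volume a b)
    (hw_nonneg : ∀ t ∈ Set.Icc a b, 0 ≤ w t)
    (hf'int : IntervalIntegrable f' volume a b)
    (hftc : ∀ y ∈ Set.Icc a b, f y = f a + ∫ t in a..y, f' t)
    (x : ℝ) (hx : x ∈ Set.Ioo a b)
    (hmax : 0 < ∫ t in a..x, w t) (hmxb : 0 < ∫ t in x..b, w t) :
    |f x - (1 / (α + β)) *
        (α * ((∫ t in a..x, f t * w t) / (∫ t in a..x, w t)) +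
          β * ((∫ t in x..b, f t * w t) / (∫ t in x..b, w t)))| ≤
      (1 / 2) * (1 + |α - β| / (α + β)) * ∫ t in a..b, |f' t| := by
  obtain ⟨hax, hxb⟩ := hx
  have hsub : ∀ {g : ℝ → ℝ}, IntervalIntegrable g volume a b →
      IntervalIntegrable g volume a x ∧ IntervalIntegrable g volume x b := fun hg =>
    ⟨hg.mono_set (by
      rw [Set.uIcc_of_le hax.le, Set.uIcc_of_le hab.le]; exact Set.Icc_subset_Icc le_rfl hxb.le),
    hg.mono_set (by
      rw [Set.uIcc_of_le hxb.le, Set.uIcc_of_le hab.le]; exact Set.Icc_subset_Icc hax.le le_rfl)⟩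
  have hcont : ContinuousOn f (Set.Icc a b) := by
    have h := continuousOn_primitive_interval' hf'int Set.left_mem_uIcc
    rw [Set.uIcc_of_le hab.le] at h
    exact (continuousOn_const.add h).congr hftc
  have hleft := abs_sub_weighted_mean_le_s9 (y := f x) hax.le
    (hcont.mono (Set.Icc_subset_Icc le_rfl hxb.le)) (hsub hw_int).1
    (fun t ht => hw_nonneg t ⟨ht.1, ht.2.trans hxb.le⟩) hmax
    fun t ht => abs_sub_le_integral_abs_of_eq_integral hf'int hftc le_rfl hxb.le ht.1 ht.2 le_rfl
  have hright := abs_sub_weighted_mean_le_s9 (y := f x) hxb.le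
    (hcont.mono (Set.Icc_subset_Icc hax.le le_rfl)) (hsub hw_int).2
    (fun t ht => hw_nonneg t ⟨hax.le.trans ht.1, ht.2⟩) hmxb
    fun t ht => by
      rw [abs_sub_comm]
      exact abs_sub_le_integral_abs_of_eq_integral hf'int hftc hax.le le_rfl le_rfl ht.1 ht.2
  rw [← integral_add_adjacent_intervals (hsub hf'int).1.abs (hsub hf'int).2.abs]
  set P := (∫ t in a..x, f t * w t) / (∫ t in a..x, w t)
  set Q := (∫ t in x..b, f t * w t) / (∫ t in x..b, w t)
  set A := ∫ t in a..x, |f' t|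
  set B := ∫ t in x..b, |f' t|
  have hA : 0 ≤ A := (abs_nonneg _).trans hleft
  have hB : 0 ≤ B := (abs_nonneg _).trans hright
  have hlhs : f x - 1 / (α + β) * (α * P + β * Q) =
      (α * (f x - P) + β * (f x - Q)) / (α + β) := by
    field_simp
    ring
  have hrhs : 1 / 2 * (1 + |α - β| / (α + β)) * (A + B) =
      (α + β + |α - β|) / 2 * (A + B) / (α + β) := by
    field_simp
  rw [hlhs, hrhs, abs_div, abs_of_pos hαβ]
  refine div_le_div_of_nonneg_right ?_ hαβ.le
  calc |α * (f x - P) + β * (f x - Q)|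
      ≤ |α * (f x - P)| + |β * (f x - Q)| := abs_add_le _ _
    _ = α * |f x - P| + β * |f x - Q| := by
      rw [abs_mul, abs_mul, abs_of_nonneg hα, abs_of_nonneg hβ]
    _ ≤ α * A + β * B := by gcongr
    _ ≤ (α + β + |α - β|) / 2 * A + (α + β + |α - β|) / 2 * B := by
      gcongr
      · linarith [le_abs_self (α - β)]
      · linarith [neg_abs_le (α - β)]
    _ = (α + β + |α - β|) / 2 * (A + B) := by ring
end

section
/- Let f : [a,b] → [0,∞) be an absolutely continuous probability density with respect to the weight w, i.e. ∫_a^b f(u)w(u) du = 1, with f' essentially bounded, let w : [a,b] → [0,∞) be integrable, let α, β ≥ 0 with α + β > 0, and let x ∈ (a,b) be such that m(a,x) > 0, m(x,b) > 0, and w(u) ≤ w(x) for almost every u ∈ [a,b]. Then |(α·m(x,b) − β·m(a,x))·F_w(x) − m(a,x)·[(α+β)·m(x,b)·f(x) − β]| ≤ (1/2)·[α·m(x,b)·(x−a)² + β·m(a,x)·(b−x)²]·w(x)·‖f'‖_∞. -/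
open MeasureTheory intervalIntegral

/-- If `f` is `M`-Lipschitz about `x` on `[c, d]`, and there `0 ≤ w` and `w ≤ W` a.e., then
replacing `f` by `f x` in `∫ f * w` costs at most `∫ M * |u - x| * W`. -/
theorem abs_integral_mul_sub_le {c d x M W : ℝ} {f w : ℝ → ℝ} (hcd : c ≤ d)
    (hf : ContinuousOn f (Set.Icc c d)) (hM : 0 ≤ M)
    (hLip : ∀ u ∈ Set.Icc c d, |f u - f x| ≤ M * |u - x|)
    (hw : IntervalIntegrable w volume c d) (hw_nonneg : ∀ u ∈ Set.Icc c d, 0 ≤ w u)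
    (hW : ∀ᵐ u ∂(volume.restrict (Set.Icc c d)), w u ≤ W) :
    |(∫ u in c..d, f u * w u) - (∫ u in c..d, w u) * f x| ≤
      ∫ u in c..d, M * |u - x| * W := by
  have hfw : IntervalIntegrable (fun u => f u * w u) volume c d :=
    hw.continuousOn_mul (by rwa [Set.uIcc_of_le hcd])
  have hsub : (∫ u in c..d, f u * w u) - (∫ u in c..d, w u) * f x
      = ∫ u in c..d, (f u - f x) * w u := by
    rw [mul_comm (∫ u in c..d, w u), ← intervalIntegral.integral_const_mul,
      ← intervalIntegral.integral_sub hfw (hw.const_mul _)]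
    simp only [sub_mul]
  rw [hsub, ← Real.norm_eq_abs]
  refine intervalIntegral.norm_integral_le_of_norm_le hcd ?_
    (Continuous.intervalIntegrable (by fun_prop) _ _)
  filter_upwards [(ae_restrict_iff' measurableSet_Icc).1 hW] with u hu hmem
  have hmem' := Set.Ioc_subset_Icc_self hmem
  rw [Real.norm_eq_abs, abs_mul, abs_of_nonneg (hw_nonneg u hmem')]
  exact mul_le_mul (hLip u hmem') (hu hmem') (hw_nonneg u hmem') (by positivity)

/-- **Theorem 4, `L_∞` case** (application to the weighted cumulative distribution
function). Let `f ≥ 0` be an absolutely continuous probability density with respect to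
the weight `w` on `[a,b]` (i.e. `∫_a^b f·w = 1`), expressed via the fundamental theorem
of calculus with integrable density `f'` essentially bounded by `M`, let `w ≥ 0` be
integrable, `α, β ≥ 0` with `α + β > 0`, and let `x ∈ (a,b)` satisfy `m(a,x) > 0`,
`m(x,b) > 0` and `w(u) ≤ w(x)` for a.e. `u ∈ [a,b]`. Then with `F_w(x) = ∫_a^x f·w`,
`|(α·m(x,b) − β·m(a,x))·F_w(x) − m(a,x)·((α+β)·m(x,b)·f(x) − β)|
  ≤ (1/2)·(α·m(x,b)·(x−a)² + β·m(a,x)·(b−x)²)·w(x)·M`. -/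
theorem weighted_cdf_Linfty (a b : ℝ) (hab : a < b) (f f' w : ℝ → ℝ) (M α β : ℝ)
    (hα : 0 ≤ α) (hβ : 0 ≤ β) (hαβ : 0 < α + β)
    (hf_nonneg : ∀ t ∈ Set.Icc a b, 0 ≤ f t)
    (hw_int : IntervalIntegrable w volume a b)
    (hw_nonneg : ∀ t ∈ Set.Icc a b, 0 ≤ w t)
    (hf'int : IntervalIntegrable f' volume a b)
    (hftc : ∀ y ∈ Set.Icc a b, f y = f a + ∫ t in a..y, f' t)
    (hpdf : (∫ u in a..b, f u * w u) = 1)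
    (hM : ∀ᵐ t ∂(volume.restrict (Set.Icc a b)), |f' t| ≤ M)
    (x : ℝ) (hx : x ∈ Set.Ioo a b)
    (hmax : 0 < ∫ t in a..x, w t) (hmxb : 0 < ∫ t in x..b, w t)
    (hw_le : ∀ᵐ u ∂(volume.restrict (Set.Icc a b)), w u ≤ w x) :
    |(α * (∫ t in x..b, w t) - β * (∫ t in a..x, w t)) * (∫ u in a..x, f u * w u) -
        (∫ t in a..x, w t) * ((α + β) * (∫ t in x..b, w t) * f x - β)| ≤
      (1 / 2) *
        (α * (∫ t in x..b, w t) * (x - a) ^ 2 +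
          β * (∫ t in a..x, w t) * (b - x) ^ 2) * w x * M := by
  obtain ⟨hax, hxb⟩ := hx
  have hxI : x ∈ Set.Icc a b := ⟨hax.le, hxb.le⟩
  have hM0 : 0 ≤ M := by
    have hne : volume.restrict (Set.Icc a b) ≠ 0 := by
      simp [Measure.restrict_eq_zero, hab]
    have : (ae (volume.restrict (Set.Icc a b))).NeBot := ae_neBot.2 hne
    obtain ⟨t, ht⟩ := hM.exists
    exact (abs_nonneg _).trans ht
  have hLip : ∀ u ∈ Set.Icc a b, ∀ v ∈ Set.Icc a b, |f u - f v| ≤ M * |u - v| := by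
    intro u hu v hv
    have hint : ∀ y ∈ Set.Icc a b, IntervalIntegrable f' volume a y := fun y hy =>
      hf'int.mono_set (by
        rw [Set.uIcc_of_le hy.1, Set.uIcc_of_le hab.le]; exact Set.Icc_subset_Icc_right hy.2)
    rw [hftc u hu, hftc v hv, add_sub_add_left_eq_sub,
      intervalIntegral.integral_interval_sub_left (hint u hu) (hint v hv), ← Real.norm_eq_abs]
    refine intervalIntegral.norm_integral_le_of_norm_le_const_ae ?_
    filter_upwards [(ae_restrict_iff' measurableSet_Icc).1 hM] with t ht hmem
    exact ht (Set.uIcc_subset_Icc hv hu (Set.uIoc_subset_uIcc hmem))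
  have hcont : ContinuousOn f (Set.Icc a b) :=
    (LipschitzOnWith.of_dist_le_mul (K := ⟨M, hM0⟩) fun u hu v hv => hLip u hu v hv).continuousOn
  have hsubL : Set.Icc a x ⊆ Set.Icc a b := Set.Icc_subset_Icc_right hxb.le
  have hsubR : Set.Icc x b ⊆ Set.Icc a b := Set.Icc_subset_Icc_left hax.le
  have hwL : IntervalIntegrable w volume a x := hw_int.mono_set (by
    rwa [Set.uIcc_of_le hax.le, Set.uIcc_of_le hab.le])
  have hwR : IntervalIntegrable w volume x b := hw_int.mono_set (by
    rwa [Set.uIcc_of_le hxb.le, Set.uIcc_of_le hab.le])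
  have hL := abs_integral_mul_sub_le hax.le (hcont.mono hsubL) hM0
    (fun u hu => hLip u (hsubL hu) x hxI) hwL (fun u hu => hw_nonneg u (hsubL hu))
    (ae_restrict_of_ae_restrict_of_subset hsubL hw_le)
  have hR := abs_integral_mul_sub_le hxb.le (hcont.mono hsubR) hM0
    (fun u hu => hLip u (hsubR hu) x hxI) hwR (fun u hu => hw_nonneg u (hsubR hu))
    (ae_restrict_of_ae_restrict_of_subset hsubR hw_le)
  have hIL : ∫ u in a..x, M * |u - x| * w x = M * ((x - a) ^ 2 / 2) * w x := by
    have : ∫ u in a..x, |u - x| = ∫ u in a..x, (x - u) := by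
      refine intervalIntegral.integral_congr fun u hu => ?_
      rw [Set.uIcc_of_le hax.le] at hu
      simp only [abs_of_nonpos (sub_nonpos.2 hu.2), neg_sub]
    rw [intervalIntegral.integral_mul_const, intervalIntegral.integral_const_mul, this,
      intervalIntegral.integral_comp_sub_left (fun u => u), integral_id]
    ring
  have hIR : ∫ u in x..b, M * |u - x| * w x = M * ((b - x) ^ 2 / 2) * w x := by
    have : ∫ u in x..b, |u - x| = ∫ u in x..b, (u - x) := by
      refine intervalIntegral.integral_congr fun u hu => ?_
      rw [Set.uIcc_of_le hxb.le] at hu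
      simp only [abs_of_nonneg (sub_nonneg.2 hu.1)]
    rw [intervalIntegral.integral_mul_const, intervalIntegral.integral_const_mul, this,
      intervalIntegral.integral_comp_sub_right (fun u => u), integral_id]
    ring
  rw [hIL] at hL
  rw [hIR] at hR
  have hsplit : (∫ u in a..x, f u * w u) + ∫ u in x..b, f u * w u = 1 := by
    rw [← hpdf]
    exact intervalIntegral.integral_add_adjacent_intervals
      (hwL.continuousOn_mul (by rw [Set.uIcc_of_le hax.le]; exact hcont.mono hsubL))
      (hwR.continuousOn_mul (by rw [Set.uIcc_of_le hxb.le]; exact hcont.mono hsubR))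
  generalize (∫ t in a..x, w t) = A at *
  generalize (∫ t in x..b, w t) = B at *
  generalize (∫ u in a..x, f u * w u) = F at *
  generalize (∫ u in x..b, f u * w u) = G at *
  obtain rfl : G = 1 - F := by linarith
  have hαB : 0 ≤ α * B := by positivity
  have hβA : 0 ≤ β * A := by positivity
  calc |(α * B - β * A) * F - A * ((α + β) * B * f x - β)|
      = |α * B * (F - A * f x) + β * A * (1 - F - B * f x)| := by congr 1; ring
    _ ≤ α * B * |F - A * f x| + β * A * |1 - F - B * f x| := by
      refine (abs_add_le _ _).trans_eq ?_
      rw [abs_mul (α * B), abs_mul (β * A), abs_of_nonneg hαB, abs_of_nonneg hβA]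
    _ ≤ α * B * (M * ((x - a) ^ 2 / 2) * w x) + β * A * (M * ((b - x) ^ 2 / 2) * w x) := by
      gcongr
    _ = _ := by ring
end

section
/- Let f : [a,b] → [0,∞) be an absolutely continuous probability density with respect to the weight w, i.e. ∫_a^b f(u)w(u) du = 1, with f' essentially bounded, let w : [a,b] → [0,∞) be integrable, and let x ∈ (a,b) be such that m(a,x) > 0, m(x,b) > 0, and w(u) ≤ w(x) for almost every u ∈ [a,b]. Then |(1/2)·(m(x,b) − m(a,x))·F_w(x) − m(a,x)·[m(x,b)·f(x) − 1/2]| ≤ (1/4)·[m(x,b)·(x−a)² + m(a,x)·(b−x)²]·w(x)·‖f'‖_∞. -/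
open MeasureTheory intervalIntegral

/-- A primitive of an almost everywhere bounded function is Lipschitz. -/
theorem abs_sub_le_of_ae_bound_density {a b M : ℝ} (hab : a ≤ b) {f f' : ℝ → ℝ}
    (hf'int : IntervalIntegrable f' volume a b)
    (hftc : ∀ y ∈ Set.Icc a b, f y = f a + ∫ t in a..y, f' t)
    (hM : ∀ᵐ t ∂(volume.restrict (Set.Icc a b)), |f' t| ≤ M)
    {x y : ℝ} (hx : x ∈ Set.Icc a b) (hy : y ∈ Set.Icc a b) :
    |f y - f x| ≤ M * |y - x| := by
  have hint : ∀ z ∈ Set.Icc a b, IntervalIntegrable f' volume a z := fun z hz =>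
    hf'int.mono_set (by
      rw [Set.uIcc_of_le hab, Set.uIcc_of_le hz.1]
      exact Set.Icc_subset_Icc_right hz.2)
  have hdiff : f y - f x = ∫ t in x..y, f' t := by
    rw [hftc y hy, hftc x hx, ← integral_interval_sub_left (hint y hy) (hint x hx)]
    ring
  rw [hdiff, ← Real.norm_eq_abs]
  apply norm_integral_le_of_norm_le_const_ae
  filter_upwards [(ae_restrict_iff' measurableSet_Icc).1 hM] with t ht hmem
  exact ht (Set.uIcc_subset_Icc hx hy (Set.uIoc_subset_uIcc hmem))

/-- If `g` grows at most linearly away from `x` and `w` is essentially bounded by `W`, then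
the integral of `g * w` is bounded by that of the linear majorant. -/
theorem abs_integral_mul_le_of_abs_le_linear {c d x M W : ℝ} (hcd : c ≤ d) {g w : ℝ → ℝ}
    (hg : ∀ u ∈ Set.Icc c d, |g u| ≤ M * |u - x|)
    (hw_nonneg : ∀ u ∈ Set.Icc c d, 0 ≤ w u)
    (hw_le : ∀ᵐ u ∂(volume.restrict (Set.Icc c d)), w u ≤ W) :
    |∫ u in c..d, g u * w u| ≤ W * M * ∫ u in c..d, |u - x| := by
  rw [← intervalIntegral.integral_const_mul, ← Real.norm_eq_abs]
  apply norm_integral_le_of_norm_le hcd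
  · filter_upwards [(ae_restrict_iff' measurableSet_Icc).1 hw_le] with u hu hmem
    have hmem' := Set.Ioc_subset_Icc_self hmem
    have hg' := hg u hmem'
    have hw' := hw_nonneg u hmem'
    rw [norm_mul, Real.norm_eq_abs, Real.norm_eq_abs, abs_of_nonneg hw']
    calc |g u| * w u ≤ (M * |u - x|) * W :=
          mul_le_mul hg' (hu hmem') hw' ((abs_nonneg _).trans hg')
      _ = W * M * |u - x| := by ring
  · exact Continuous.intervalIntegrable (by fun_prop) _ _

theorem integral_abs_sub_left {a x : ℝ} (h : a ≤ x) :
    ∫ u in a..x, |u - x| = (x - a) ^ 2 / 2 := by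
  have : ∫ u in a..x, |u - x| = ∫ u in a..x, (x - u) := by
    refine integral_congr fun u hu => ?_
    rw [Set.uIcc_of_le h] at hu
    rw [abs_of_nonpos (by linarith [hu.2]), neg_sub]
  rw [this, intervalIntegral.integral_sub (by simp) (by simp), integral_id,
    intervalIntegral.integral_const, smul_eq_mul]
  ring

theorem integral_abs_sub_right {x b : ℝ} (h : x ≤ b) :
    ∫ u in x..b, |u - x| = (b - x) ^ 2 / 2 := by
  have : ∫ u in x..b, |u - x| = ∫ u in x..b, (u - x) := by
    refine integral_congr fun u hu => ?_
    rw [Set.uIcc_of_le h] at hu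
    exact abs_of_nonneg (by linarith [hu.1])
  rw [this, intervalIntegral.integral_sub (by simp) (by simp), integral_id,
    intervalIntegral.integral_const, smul_eq_mul]
  ring

/-- **Corollary 4, `L_∞` case** (symmetric application to the weighted cumulative
distribution function). Let `f ≥ 0` be an absolutely continuous probability density with
respect to the weight `w` on `[a,b]` (i.e. `∫_a^b f·w = 1`), expressed via the
fundamental theorem of calculus with integrable density `f'` essentially bounded by `M`,
let `w ≥ 0` be integrable, and let `x ∈ (a,b)` satisfy `m(a,x) > 0`, `m(x,b) > 0` and
`w(u) ≤ w(x)` for a.e. `u ∈ [a,b]`. Then with `F_w(x) = ∫_a^x f·w`,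
`|(1/2)·(m(x,b) − m(a,x))·F_w(x) − m(a,x)·(m(x,b)·f(x) − 1/2)|
  ≤ (1/4)·(m(x,b)·(x−a)² + m(a,x)·(b−x)²)·w(x)·M`. -/
theorem weighted_cdf_symmetric_Linfty (a b : ℝ) (hab : a < b) (f f' w : ℝ → ℝ) (M : ℝ)
    (hf_nonneg : ∀ t ∈ Set.Icc a b, 0 ≤ f t)
    (hw_int : IntervalIntegrable w volume a b)
    (hw_nonneg : ∀ t ∈ Set.Icc a b, 0 ≤ w t)
    (hf'int : IntervalIntegrable f' volume a b)
    (hftc : ∀ y ∈ Set.Icc a b, f y = f a + ∫ t in a..y, f' t)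
    (hpdf : (∫ u in a..b, f u * w u) = 1)
    (hM : ∀ᵐ t ∂(volume.restrict (Set.Icc a b)), |f' t| ≤ M)
    (x : ℝ) (hx : x ∈ Set.Ioo a b)
    (hmax : 0 < ∫ t in a..x, w t) (hmxb : 0 < ∫ t in x..b, w t)
    (hw_le : ∀ᵐ u ∂(volume.restrict (Set.Icc a b)), w u ≤ w x) :
    |(1 / 2) * ((∫ t in x..b, w t) - (∫ t in a..x, w t)) * (∫ u in a..x, f u * w u) -
        (∫ t in a..x, w t) * ((∫ t in x..b, w t) * f x - 1 / 2)| ≤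
      (1 / 4) *
        ((∫ t in x..b, w t) * (x - a) ^ 2 + (∫ t in a..x, w t) * (b - x) ^ 2) *
        w x * M := by
  have hxI : x ∈ Set.Icc a b := Set.Ioo_subset_Icc_self hx
  have hax := hxI.1
  have hxb := hxI.2
  have hlip : ∀ u ∈ Set.Icc a b, |f u - f x| ≤ M * |u - x| := fun u hu =>
    abs_sub_le_of_ae_bound_density hab.le hf'int hftc hM hxI hu
  have hcont : ContinuousOn f (Set.uIcc a b) := by
    have hprim : ContinuousOn (fun y => f a + ∫ t in a..y, f' t) (Set.uIcc a b) :=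
      continuousOn_const.add (continuousOn_primitive_interval' hf'int Set.left_mem_uIcc)
    refine hprim.congr fun y hy => ?_
    rw [Set.uIcc_of_le hab.le] at hy
    exact hftc y hy
  have hfw : IntervalIntegrable (fun u => f u * w u) volume a b :=
    hw_int.continuousOn_mul hcont
  have hleft : Set.uIcc a x ⊆ Set.uIcc a b :=
    Set.uIcc_subset_uIcc_left (by rwa [Set.uIcc_of_le hab.le])
  have hright : Set.uIcc x b ⊆ Set.uIcc a b :=
    Set.uIcc_subset_uIcc_right (by rwa [Set.uIcc_of_le hab.le])
  have hsplit := integral_add_adjacent_intervals (hfw.mono_set hleft) (hfw.mono_set hright)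
  rw [hpdf] at hsplit
  have key : ∀ c d, c ≤ d → Set.uIcc c d ⊆ Set.uIcc a b →
      |(∫ u in c..d, f u * w u) - f x * ∫ u in c..d, w u| ≤
        w x * M * ∫ u in c..d, |u - x| := by
    intro c d hcd hsub
    have hsub' : Set.Icc c d ⊆ Set.Icc a b := by
      rwa [Set.uIcc_of_le hcd, Set.uIcc_of_le hab.le] at hsub
    have heq : (∫ u in c..d, f u * w u) - f x * ∫ u in c..d, w u =
        ∫ u in c..d, (f u - f x) * w u := by
      rw [← intervalIntegral.integral_const_mul, ← intervalIntegral.integral_sub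
        (hfw.mono_set hsub) ((hw_int.mono_set hsub).const_mul _)]
      simp only [sub_mul]
    rw [heq]
    exact abs_integral_mul_le_of_abs_le_linear hcd (fun u hu => hlip u (hsub' hu))
      (fun u hu => hw_nonneg u (hsub' hu)) (ae_restrict_of_ae_restrict_of_subset hsub' hw_le)
  have h₁ := key a x hax hleft
  have h₂ := key x b hxb hright
  rw [integral_abs_sub_left hax] at h₁
  rw [integral_abs_sub_right hxb] at h₂
  set A := ∫ t in a..x, w t
  set B := ∫ t in x..b, w t
  set F := ∫ u in a..x, f u * w u
  set G := ∫ u in x..b, f u * w u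
  have hdecomp : (1 / 2) * (B - A) * F - A * (B * f x - 1 / 2) =
      (B / 2) * (F - f x * A) + (A / 2) * (G - f x * B) := by
    linear_combination (-A / 2) * hsplit
  rw [hdecomp]
  calc |(B / 2) * (F - f x * A) + (A / 2) * (G - f x * B)|
      ≤ |(B / 2) * (F - f x * A)| + |(A / 2) * (G - f x * B)| := abs_add_le _ _
    _ = (B / 2) * |F - f x * A| + (A / 2) * |G - f x * B| := by
      rw [abs_mul, abs_mul, abs_of_pos (half_pos hmxb), abs_of_pos (half_pos hmax)]
    _ ≤ (B / 2) * (w x * M * ((x - a) ^ 2 / 2)) + (A / 2) * (w x * M * ((b - x) ^ 2 / 2)) := by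
      gcongr
    _ = _ := by ring
end

section
/- Let f : [a,b] → [0,∞) be an absolutely continuous probability density with respect to the weight w, i.e. ∫_a^b f(u)w(u) du = 1, let w : [a,b] → [0,∞) be integrable, and let x ∈ (a,b) be such that m(a,x) > 0 and m(x,b) > 0. Then |(1/2)·(m(x,b) − m(a,x))·F_w(x) − m(a,x)·[m(x,b)·f(x) − 1/2]| ≤ (1/2)·m(x,b)·m(a,x)·‖f'‖_1. -/
open MeasureTheory intervalIntegral

/-- A uniform bound `C` for `|f - k|` bounds the deviation of `∫ f * w` from `k * ∫ w` by
`C * ∫ w`. -/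
theorem abs_integral_mul_sub_const_mul_le {c d k C : ℝ} {f w : ℝ → ℝ} (hcd : c ≤ d)
    (hfw : IntervalIntegrable (fun u => f u * w u) volume c d)
    (hw : IntervalIntegrable w volume c d) (hw_nonneg : ∀ t ∈ Set.Icc c d, 0 ≤ w t)
    (hC : ∀ t ∈ Set.Icc c d, |f t - k| ≤ C) :
    |(∫ u in c..d, f u * w u) - k * ∫ u in c..d, w u| ≤ C * ∫ u in c..d, w u := by
  rw [← intervalIntegral.integral_const_mul, ← intervalIntegral.integral_sub hfw (hw.const_mul k),
    ← intervalIntegral.integral_const_mul]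
  refine (abs_integral_le_integral_abs hcd).trans
    (integral_mono_on hcd (hfw.sub (hw.const_mul k)).abs (hw.const_mul C) fun t ht => ?_)
  rw [← sub_mul, abs_mul, abs_of_nonneg (hw_nonneg t ht)]
  exact mul_le_mul_of_nonneg_right (hC t ht) (hw_nonneg t ht)

/-- The increment of a primitive over a subinterval is at most the `L¹` norm of its density. -/
theorem abs_integral_le_integral_abs_of_subinterval {c d s t : ℝ} {g : ℝ → ℝ}
    (hg : IntervalIntegrable g volume c d) (hcs : c ≤ s) (hst : s ≤ t) (htd : t ≤ d) :
    |∫ u in s..t, g u| ≤ ∫ u in c..d, |g u| :=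
  (abs_integral_le_integral_abs hst).trans
    (integral_mono_interval hcs hst htd (Filter.Eventually.of_forall fun _ => abs_nonneg _) hg.abs)

/-- **Corollary 4, `L_1` case** (symmetric application to the weighted cumulative
distribution function). Let `f ≥ 0` be an absolutely continuous probability density with
respect to the weight `w` on `[a,b]` (i.e. `∫_a^b f·w = 1`), expressed via the
fundamental theorem of calculus with integrable density `f'`, let `w ≥ 0` be integrable,
and let `x ∈ (a,b)` satisfy `m(a,x) > 0` and `m(x,b) > 0`. Then with
`F_w(x) = ∫_a^x f·w`,
`|(1/2)·(m(x,b) − m(a,x))·F_w(x) − m(a,x)·(m(x,b)·f(x) − 1/2)|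
  ≤ (1/2)·m(x,b)·m(a,x)·‖f'‖_1`. -/
theorem weighted_cdf_symmetric_L1 (a b : ℝ) (hab : a < b) (f f' w : ℝ → ℝ)
    (hf_nonneg : ∀ t ∈ Set.Icc a b, 0 ≤ f t)
    (hw_int : IntervalIntegrable w volume a b)
    (hw_nonneg : ∀ t ∈ Set.Icc a b, 0 ≤ w t)
    (hf'int : IntervalIntegrable f' volume a b)
    (hftc : ∀ y ∈ Set.Icc a b, f y = f a + ∫ t in a..y, f' t)
    (hpdf : (∫ u in a..b, f u * w u) = 1)
    (x : ℝ) (hx : x ∈ Set.Ioo a b)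
    (hmax : 0 < ∫ t in a..x, w t) (hmxb : 0 < ∫ t in x..b, w t) :
    |(1 / 2) * ((∫ t in x..b, w t) - (∫ t in a..x, w t)) * (∫ u in a..x, f u * w u) -
        (∫ t in a..x, w t) * ((∫ t in x..b, w t) * f x - 1 / 2)| ≤
      (1 / 2) * (∫ t in x..b, w t) * (∫ t in a..x, w t) * ∫ t in a..b, |f' t| := by
  have hax := hx.1.le
  have hxb := hx.2.le
  have hxm : x ∈ Set.Icc a b := ⟨hax, hxb⟩
  have hxu : x ∈ Set.uIcc a b := by rwa [Set.uIcc_of_le hab.le]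
  have hsub₁ : Set.uIcc a x ⊆ Set.uIcc a b := Set.uIcc_subset_uIcc_left hxu
  have hsub₂ : Set.uIcc x b ⊆ Set.uIcc a b := Set.uIcc_subset_uIcc_right hxu
  have hcont : ContinuousOn f (Set.uIcc a b) := by
    have h := (continuousOn_const (c := f a)).add
      (continuousOn_primitive_interval' hf'int Set.left_mem_uIcc)
    exact h.congr fun y hy => hftc y (by rwa [Set.uIcc_of_le hab.le] at hy)
  have hfw : IntervalIntegrable (fun u => f u * w u) volume a b :=
    hw_int.continuousOn_mul hcont
  have hdiff : ∀ s ∈ Set.Icc a b, ∀ t ∈ Set.Icc a b, f t - f s = ∫ u in s..t, f' u := by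
    intro s hs t ht
    have hi : ∀ y ∈ Set.Icc a b, IntervalIntegrable f' volume a y := fun y hy =>
      hf'int.mono_set (Set.uIcc_subset_uIcc_left (by rwa [Set.uIcc_of_le hab.le]))
    rw [hftc t ht, hftc s hs, add_sub_add_left_eq_sub,
      integral_interval_sub_left (hi t ht) (hi s hs)]
  have hleft := abs_integral_mul_sub_const_mul_le (k := f x) (C := ∫ t in a..x, |f' t|) hax
    (hfw.mono_set hsub₁) (hw_int.mono_set hsub₁)
    (fun t ht => hw_nonneg t ⟨ht.1, ht.2.trans hxb⟩) fun t ht => by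
      rw [abs_sub_comm, hdiff t ⟨ht.1, ht.2.trans hxb⟩ x hxm]
      exact abs_integral_le_integral_abs_of_subinterval (hf'int.mono_set hsub₁) ht.1 ht.2 le_rfl
  have hright := abs_integral_mul_sub_const_mul_le (k := f x) (C := ∫ t in x..b, |f' t|) hxb
    (hfw.mono_set hsub₂) (hw_int.mono_set hsub₂)
    (fun t ht => hw_nonneg t ⟨hax.trans ht.1, ht.2⟩) fun t ht => by
      rw [hdiff x hxm t ⟨hax.trans ht.1, ht.2⟩]
      exact abs_integral_le_integral_abs_of_subinterval (hf'int.mono_set hsub₂) le_rfl ht.1 ht.2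
  have hsum := integral_add_adjacent_intervals (hfw.mono_set hsub₁) (hfw.mono_set hsub₂)
  rw [hpdf] at hsum
  rw [← integral_add_adjacent_intervals (hf'int.mono_set hsub₁).abs (hf'int.mono_set hsub₂).abs]
  rw [← eq_sub_iff_add_eq'] at hsum
  rw [hsum] at hright
  rw [abs_le] at hleft hright ⊢
  constructor <;>
    nlinarith [mul_le_mul_of_nonneg_left hleft.1 hmxb.le, mul_le_mul_of_nonneg_left hleft.2 hmxb.le,
      mul_le_mul_of_nonneg_left hright.1 hmax.le, mul_le_mul_of_nonneg_left hright.2 hmax.le]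
end

section
/- Let f : [a,b] → [0,∞) be an absolutely continuous probability density with respect to the weight w, i.e. ∫_a^b f(u)w(u) du = 1, with f' essentially bounded, let w : [a,b] → [0,∞) be integrable, and let x ∈ (a,b) be such that m(a,x) > 0 and w(u) ≤ w(x) for almost every u ∈ [a,x]. Then |m(a,x)·f(x) − F_w(x)| ≤ ((x−a)²/2)·w(x)·‖f'‖_∞. -/
open MeasureTheory intervalIntegral

/-- **Remark 6** (`β = 0` case, application to the weighted cumulative distribution
function). Let `f ≥ 0` be an absolutely continuous probability density with respect to
the weight `w` on `[a,b]` (i.e. `∫_a^b f·w = 1`), expressed via the fundamental theorem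
of calculus with integrable density `f'` essentially bounded by `M`, let `w ≥ 0` be
integrable, and let `x ∈ (a,b)` satisfy `m(a,x) > 0` and `w(u) ≤ w(x)` for a.e.
`u ∈ [a,x]`. Then with `F_w(x) = ∫_a^x f·w`,
`|m(a,x)·f(x) − F_w(x)| ≤ ((x−a)²/2)·w(x)·M`. -/
theorem weighted_cdf_beta_zero (a b : ℝ) (hab : a < b) (f f' w : ℝ → ℝ) (M : ℝ)
    (hf_nonneg : ∀ t ∈ Set.Icc a b, 0 ≤ f t)
    (hw_int : IntervalIntegrable w volume a b)
    (hw_nonneg : ∀ t ∈ Set.Icc a b, 0 ≤ w t)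
    (hf'int : IntervalIntegrable f' volume a b)
    (hftc : ∀ y ∈ Set.Icc a b, f y = f a + ∫ t in a..y, f' t)
    (hpdf : (∫ u in a..b, f u * w u) = 1)
    (hM : ∀ᵐ t ∂(volume.restrict (Set.Icc a b)), |f' t| ≤ M)
    (x : ℝ) (hx : x ∈ Set.Ioo a b)
    (hmax : 0 < ∫ t in a..x, w t)
    (hw_le : ∀ᵐ u ∂(volume.restrict (Set.Icc a x)), w u ≤ w x) :
    |(∫ t in a..x, w t) * f x - ∫ u in a..x, f u * w u| ≤
      ((x - a) ^ 2 / 2) * w x * M := by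
  have hax : a ≤ x := hx.1.le
  have hsub : Set.Icc a x ⊆ Set.Icc a b := Set.Icc_subset_Icc_right hx.2.le
  have hfcont : ContinuousOn f (Set.uIcc a x) := by
    have hprim : ContinuousOn (fun y => f a + ∫ t in a..y, f' t) (Set.uIcc a b) :=
      continuousOn_const.add (continuousOn_primitive_interval' hf'int Set.left_mem_uIcc)
    rw [Set.uIcc_of_le hab.le] at hprim
    rw [Set.uIcc_of_le hax]
    exact (hprim.congr hftc).mono hsub
  have hwx : IntervalIntegrable w volume a x :=
    hw_int.mono_set (by rwa [Set.uIcc_of_le hax, Set.uIcc_of_le hab.le])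
  have hdiff : (∫ t in a..x, w t) * f x - ∫ u in a..x, f u * w u =
      ∫ u in a..x, (f x - f u) * w u := by
    simp only [sub_mul]
    rw [integral_sub (hwx.const_mul (f x)) (hwx.continuousOn_mul hfcont),
      intervalIntegral.integral_const_mul, mul_comm]
  have hlip : ∀ u ∈ Set.Icc a x, |f x - f u| ≤ M * (x - u) := by
    intro u hu
    have hint : ∀ y ∈ Set.Icc a b, IntervalIntegrable f' volume a y := fun y hy =>
      hf'int.mono_set (by
        rw [Set.uIcc_of_le hy.1, Set.uIcc_of_le hab.le]
        exact Set.Icc_subset_Icc_right hy.2)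
    rw [hftc x (Set.Ioo_subset_Icc_self hx), hftc u (hsub hu), add_sub_add_left_eq_sub,
      integral_interval_sub_left (hint x (Set.Ioo_subset_Icc_self hx)) (hint u (hsub hu))]
    have hbound : ∀ᵐ t, t ∈ Set.Ioc u x → ‖f' t‖ ≤ M := by
      filter_upwards [(ae_restrict_iff' measurableSet_Icc).1 hM] with t ht htu
      exact ht ⟨hu.1.trans htu.1.le, htu.2.trans hx.2.le⟩
    calc |∫ t in u..x, f' t| ≤ ∫ _ in u..x, M :=
          norm_integral_le_of_norm_le hu.2 hbound intervalIntegrable_const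
      _ = M * (x - u) := by rw [intervalIntegral.integral_const, smul_eq_mul, mul_comm]
  have hbound : ∀ᵐ u, u ∈ Set.Ioc a x → ‖(f x - f u) * w u‖ ≤ M * w x * (x - u) := by
    filter_upwards [(ae_restrict_iff' measurableSet_Icc).1 hw_le] with u hwu hu
    have hu' : u ∈ Set.Icc a x := Set.Ioc_subset_Icc_self hu
    have hw0 : 0 ≤ w u := hw_nonneg u (hsub hu')
    rw [norm_mul, Real.norm_eq_abs, Real.norm_of_nonneg hw0, mul_right_comm]
    exact mul_le_mul (hlip u hu') (hwu hu') hw0 ((abs_nonneg _).trans (hlip u hu'))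
  rw [hdiff]
  calc |∫ u in a..x, (f x - f u) * w u| ≤ ∫ u in a..x, M * w x * (x - u) :=
        norm_integral_le_of_norm_le hax hbound (Continuous.intervalIntegrable (by fun_prop) _ _)
    _ = ((x - a) ^ 2 / 2) * w x * M := by
        rw [intervalIntegral.integral_const_mul,
          intervalIntegral.integral_comp_sub_left (fun u => u) x, integral_id]
        ring
end
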